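/- arXiv:2512.22163 — 9 statements merged into one kernel-verified Lean document; each statement's English description precedes it below -/
import Mathlib

section
/- Let p ≥ 1 be an integer and Δx > 0. Define the finite-difference operators D_{2p} = Σ_{j=1}^p α_j δ_{2j} and D^{(2)}_{2p} = Σ_{j=1}^p α_j δ_j², where δ_j f(x) = (f(x + jΔx/2) − f(x − jΔx/2))/(jΔx) and α_j = 2(−1)^{j+1}(p!)²/((p+j)!(p−j)!). Then there exist constants C and C' (depending only on p) such that for every function f of class C^{2p+1} and every function g of class C^{2p+2} on an interval containing [x − pΔx, x + pΔx] one has |f'(x) − D_{2p}f(x)| ≤ C · sup_{y ∈ [x−pΔx, x+pΔx]} |f^{(2p+1)}(y)| · (Δx)^{2p} and |g''(x) − D^{(2)}_{2p} g(x)| ≤ C' · sup_{y ∈ [x−pΔx, x+pΔx]} |g^{(2p+2)}(y)| · (Δx)^{2p}. -/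
open Set

/-- The finite-difference coefficients `α_j = 2(−1)^{j+1}(p!)²/((p+j)!(p−j)!)`. -/
noncomputable def fdAlpha (p j : ℕ) : ℝ :=
  2 * (-1 : ℝ) ^ (j + 1) * (p.factorial : ℝ) ^ 2 /
    ((p + j).factorial * (p - j).factorial)

/-- The symmetric finite difference operator
`δ_j f(x) = (f(x + jΔx/2) − f(x − jΔx/2))/(jΔx)`. -/
noncomputable def fdDelta (Δx : ℝ) (j : ℕ) (f : ℝ → ℝ) : ℝ → ℝ :=
  fun x => (f (x + j * Δx / 2) - f (x - j * Δx / 2)) / (j * Δx)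

/-- Alternating binomial sums of centred even powers vanish below the order of the difference. -/
theorem sum_choose_mul_centred_pow_eq_zero {p m : ℕ} (hm : m < p) :
    ∑ k ∈ Finset.range (2 * p + 1),
      (-1 : ℝ) ^ k * ((2 * p).choose k : ℝ) * ((k : ℝ) - p) ^ (2 * m) = 0 := by
  have h := congrFun (fwdDiff_iter_pow_eq_zero_of_lt (R := ℝ) (show 2 * m < 2 * p by lia))
    (-(p : ℝ))
  rw [fwdDiff_iter_eq_sum_shift] at h
  refine Eq.trans ?_ h
  refine Finset.sum_congr rfl fun k hk => ?_
  obtain ⟨i, hi⟩ := Nat.exists_eq_add_of_le (Nat.lt_succ_iff.mp (Finset.mem_range.mp hk))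
  have hpar : (-1 : ℝ) ^ (2 * p - k) = (-1) ^ k := by
    rw [hi, Nat.add_sub_cancel_left]
    have : Even (k + i) := ⟨p, by lia⟩
    rcases Nat.even_or_odd k with hk | hk
    · rw [hk.neg_one_pow, ((Nat.even_add.mp this).mp hk).neg_one_pow]
    · rw [hk.neg_one_pow, Odd.neg_one_pow]
      grind
  simp only [zsmul_eq_mul, nsmul_eq_mul, mul_one]
  push_cast
  rw [hpar]
  ring

theorem fdAlpha_eq_choose {p j : ℕ} (hj : j ≤ p) :
    fdAlpha p j = -2 * (-1) ^ j * ((2 * p).choose (p + j) : ℝ) / ((2 * p).choose p : ℝ) := by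
  rw [Nat.cast_choose ℝ (show p + j ≤ 2 * p by lia), Nat.cast_choose ℝ (show p ≤ 2 * p by lia),
    show 2 * p - (p + j) = p - j by lia, show 2 * p - p = p by lia, fdAlpha]
  have h (n : ℕ) : (n.factorial : ℝ) ≠ 0 := by positivity
  have h1 := h p
  have h2 := h (p + j)
  have h3 := h (p - j)
  have h4 := h (2 * p)
  field_simp
  ring

/-- The moment conditions satisfied by the finite-difference coefficients. -/
theorem sum_fdAlpha_mul_pow {p m : ℕ} (hm : m < p) :
    ∑ j ∈ Finset.Icc 1 p, fdAlpha p j * (j : ℝ) ^ (2 * m) = if m = 0 then 1 else 0 := by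
  have h := sum_choose_mul_centred_pow_eq_zero hm
  rw [show 2 * p + 1 = p + (p + 1) by lia, Finset.sum_range_add, ← Finset.sum_range_reflect,
    Finset.sum_range_succ', ← add_assoc, ← Finset.sum_add_distrib] at h
  have hc : ((2 * p).choose p : ℝ) ≠ 0 := by
    exact_mod_cast (Nat.choose_pos (show p ≤ 2 * p by lia)).ne'
  have hs : ((-1 : ℝ) ^ p) * (-1) ^ p = 1 := by rw [← mul_pow]; simp
  have key : ∑ j ∈ Finset.Icc 1 p, fdAlpha p j * (j : ℝ) ^ (2 * m) =
      -((-1) ^ p / ((2 * p).choose p : ℝ)) * ∑ i ∈ Finset.range p,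
        ((-1 : ℝ) ^ (p - 1 - i) * ((2 * p).choose (p - 1 - i) : ℝ) *
            (((p - 1 - i : ℕ) : ℝ) - p) ^ (2 * m) +
          (-1 : ℝ) ^ (p + (i + 1)) * ((2 * p).choose (p + (i + 1)) : ℝ) *
            (((p + (i + 1) : ℕ) : ℝ) - p) ^ (2 * m)) := by
    rw [← Finset.Ico_add_one_right_eq_Icc, Finset.sum_Ico_eq_sum_range, Nat.add_sub_cancel,
      Finset.mul_sum]
    refine Finset.sum_congr rfl fun i hi => ?_
    obtain ⟨q, rfl⟩ := Nat.exists_eq_add_of_lt (Finset.mem_range.mp hi)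
    rw [fdAlpha_eq_choose (by lia), show i + q + 1 - 1 - i = q by lia,
      ← Nat.choose_symm (show q ≤ 2 * (i + q + 1) by lia),
      show 2 * (i + q + 1) - q = i + q + 1 + (i + 1) by lia, add_comm 1 i]
    have e1 : ((q : ℝ) - ((i + q + 1 : ℕ) : ℝ)) ^ (2 * m) = ((i : ℝ) + 1) ^ (2 * m) := by
      rw [pow_mul, pow_mul]; push_cast; ring
    have e2 : (((i + q + 1 + (i + 1) : ℕ) : ℝ) - ((i + q + 1 : ℕ) : ℝ)) = (i : ℝ) + 1 := by
      push_cast; ring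
    have e3 : (-1 : ℝ) ^ (i + q + 1) * (-1) ^ q = (-1) ^ (i + 1) := by
      rw [← pow_add, show i + q + 1 + q = i + 1 + 2 * q by lia, pow_add, pow_mul]; simp
    have e4 : (-1 : ℝ) ^ (i + q + 1) * (-1) ^ (i + q + 1 + (i + 1)) = (-1) ^ (i + 1) := by
      rw [pow_add _ (i + q + 1), ← mul_assoc, hs, one_mul]
    rw [e1, e2]
    push_cast
    linear_combination ((i : ℝ) + 1) ^ (2 * m) *
      (((2 * (i + q + 1)).choose (i + q + 1 + (i + 1)) : ℝ) /
        ((2 * (i + q + 1)).choose (i + q + 1) : ℝ)) * (e3 + e4)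
  rw [key, eq_neg_of_add_eq_zero_left h]
  simp only [add_zero, sub_self]
  split_ifs with h0
  · subst h0
    field_simp
    simp [← sq, ← pow_mul]
  · simp [h0]

/-- A weighted sum of even power expansions reproduces the leading coefficient up to the
remainder. -/
theorem abs_sub_sum_fdAlpha_mul_le {p : ℕ} (hp : 1 ≤ p) {B Δx : ℝ} {e q : ℕ → ℝ}
    (h : ∀ j ∈ Finset.Icc 1 p,
      |q j - ∑ m ∈ Finset.range p, e m * (j * Δx) ^ (2 * m)| ≤ B * (j * Δx) ^ (2 * p)) :
    |e 0 - ∑ j ∈ Finset.Icc 1 p, fdAlpha p j * q j| ≤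
      (∑ j ∈ Finset.Icc 1 p, |fdAlpha p j| * (j : ℝ) ^ (2 * p)) * B * Δx ^ (2 * p) := by
  have h0 : ∑ j ∈ Finset.Icc 1 p,
      fdAlpha p j * ∑ m ∈ Finset.range p, e m * (j * Δx) ^ (2 * m) = e 0 := by
    simp_rw [Finset.mul_sum]
    rw [Finset.sum_comm]
    have (m : ℕ) (hm : m ∈ Finset.range p) :
        ∑ j ∈ Finset.Icc 1 p, fdAlpha p j * (e m * (j * Δx) ^ (2 * m)) =
          if m = 0 then e 0 else 0 := by
      calc _ = e m * Δx ^ (2 * m) * ∑ j ∈ Finset.Icc 1 p, fdAlpha p j * (j : ℝ) ^ (2 * m) := by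
            rw [Finset.mul_sum]
            exact Finset.sum_congr rfl fun j _ => by rw [mul_pow]; ring
        _ = _ := by
            rw [sum_fdAlpha_mul_pow (Finset.mem_range.mp hm)]
            split_ifs with hm0 <;> simp [hm0]
    rw [Finset.sum_congr rfl this, Finset.sum_ite_eq' (Finset.range p) 0,
      if_pos (Finset.mem_range.mpr hp)]
  rw [abs_sub_comm]
  nth_rewrite 1 [← h0]
  rw [← Finset.sum_sub_distrib, Finset.sum_mul, Finset.sum_mul]
  refine (Finset.abs_sum_le_sum_abs _ _).trans (Finset.sum_le_sum fun j hj => ?_)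
  rw [← mul_sub, abs_mul]
  calc _ ≤ |fdAlpha p j| * (B * (j * Δx) ^ (2 * p)) :=
        mul_le_mul_of_nonneg_left (h j hj) (abs_nonneg _)
    _ = _ := by rw [mul_pow]; ring

/-- Taylor's theorem with a polynomial bound on the remainder, expanded at an arbitrary point of
the interval. -/
theorem abs_sub_taylorWithinEval_le {f : ℝ → ℝ} {a b K x y : ℝ} {n : ℕ} (hab : a < b)
    (hf : ContDiffOn ℝ (n + 1 : ℕ) f (Icc a b)) (hx : x ∈ Icc a b) (hy : y ∈ Icc a b)
    (hK : ∀ z ∈ Icc a b, |iteratedDerivWithin (n + 1) f (Icc a b) z| ≤ K) :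
    |f y - taylorWithinEval f n (Icc a b) x y| ≤ K * |y - x| ^ (n + 1) / n.factorial := by
  have hK0 : 0 ≤ K := (abs_nonneg _).trans (hK x hx)
  have hsub : uIcc x y ⊆ Icc a b := uIcc_subset_Icc hx hy
  have hf' : DifferentiableOn ℝ (iteratedDerivWithin n f (Icc a b)) (Icc a b) :=
    hf.differentiableOn_iteratedDerivWithin (mod_cast n.lt_succ_self) (uniqueDiffOn_Icc hab)
  have hderiv (t : ℝ) (ht : t ∈ uIcc x y) :
      HasDerivWithinAt (fun t => taylorWithinEval f n (Icc a b) t y)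
        (((n.factorial : ℝ)⁻¹ * (y - t) ^ n) • iteratedDerivWithin (n + 1) f (Icc a b) t)
        (uIcc x y) t :=
    (hasDerivWithinAt_taylorWithinEval_at_Icc y hab (hsub ht)
      (hf.of_le (mod_cast n.le_succ)) hf').mono hsub
  have hbound (t : ℝ) (ht : t ∈ uIcc x y) :
      ‖((n.factorial : ℝ)⁻¹ * (y - t) ^ n) • iteratedDerivWithin (n + 1) f (Icc a b) t‖ ≤
        (n.factorial : ℝ)⁻¹ * |y - x| ^ n * K := by
    rw [norm_smul, Real.norm_eq_abs, Real.norm_eq_abs, abs_mul, abs_pow, abs_inv, Nat.abs_cast]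
    have := abs_sub_right_of_mem_uIcc ht
    gcongr
    exact hK t (hsub ht)
  have := (convex_uIcc x y).norm_image_sub_le_of_norm_hasDerivWithin_le hderiv hbound
    left_mem_uIcc right_mem_uIcc
  simp only [taylorWithinEval_self, Real.norm_eq_abs] at this
  exact this.trans_eq (by ring)

theorem taylorWithinEval_eq_sum_mul_pow (f : ℝ → ℝ) (n : ℕ) (s : Set ℝ) (x y : ℝ) :
    taylorWithinEval f n s x y = ∑ k ∈ Finset.range (n + 1),
      (k.factorial : ℝ)⁻¹ * iteratedDerivWithin k f s x * (y - x) ^ k := by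
  rw [taylor_within_apply]
  exact Finset.sum_congr rfl fun k _ => mul_right_comm _ _ _

theorem sum_range_odd_part (c : ℕ → ℝ) (h : ℝ) (p : ℕ) :
    ∑ k ∈ Finset.range (2 * p + 1), c k * h ^ k - ∑ k ∈ Finset.range (2 * p + 1), c k * (-h) ^ k =
      2 * h * ∑ m ∈ Finset.range p, c (2 * m + 1) * h ^ (2 * m) := by
  induction p with
  | zero => simp
  | succ p ih =>
    rw [show 2 * (p + 1) + 1 = 2 * p + 1 + 1 + 1 by lia]
    simp only [Finset.sum_range_succ _ (2 * p + 1 + 1), Finset.sum_range_succ _ (2 * p + 1),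
      Finset.sum_range_succ _ p, mul_add, ← ih]
    rw [Odd.neg_pow (by simp), Even.neg_pow (by simp [parity_simps])]
    ring

theorem sum_range_even_part (c : ℕ → ℝ) (h : ℝ) (p : ℕ) :
    ∑ k ∈ Finset.range (2 * p + 2), c k * h ^ k + ∑ k ∈ Finset.range (2 * p + 2), c k * (-h) ^ k =
      2 * c 0 + h ^ 2 * ∑ m ∈ Finset.range p, 2 * c (2 * m + 2) * h ^ (2 * m) := by
  induction p with
  | zero => simp [Finset.sum_range_succ]; ring
  | succ p ih =>
    rw [show 2 * (p + 1) + 2 = 2 * p + 2 + 1 + 1 by lia]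
    simp only [Finset.sum_range_succ _ (2 * p + 2 + 1), Finset.sum_range_succ _ (2 * p + 2),
      Finset.sum_range_succ _ p, mul_add, ← add_assoc, ← ih]
    rw [Odd.neg_pow (n := 2 * p + 2 + 1) (by simp [parity_simps]),
      Even.neg_pow (n := 2 * p + 2) (by simp [parity_simps])]
    ring

theorem fdDelta_two_mul (Δx : ℝ) (j : ℕ) (f : ℝ → ℝ) (x : ℝ) :
    fdDelta Δx (2 * j) f x = (f (x + j * Δx) - f (x - j * Δx)) / (2 * (j * Δx)) := by
  rw [fdDelta]
  push_cast
  rw [show (2 * j * Δx / 2 : ℝ) = j * Δx by ring, mul_assoc]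

theorem fdDelta_fdDelta (Δx : ℝ) (j : ℕ) (f : ℝ → ℝ) (x : ℝ) :
    fdDelta Δx j (fdDelta Δx j f) x =
      (f (x + j * Δx) + f (x - j * Δx) - 2 * f x) / (j * Δx) ^ 2 := by
  simp only [fdDelta]
  rw [show x + j * Δx / 2 + j * Δx / 2 = x + j * Δx by ring,
    show x + j * Δx / 2 - j * Δx / 2 = x by ring,
    show x - j * Δx / 2 + j * Δx / 2 = x by ring,
    show x - j * Δx / 2 - j * Δx / 2 = x - j * Δx by ring]
  ring

theorem abs_div_sub_le {d u v w : ℝ} (hd : 0 < d) (h : |u - d * v| ≤ d * w) :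
    |u / d - v| ≤ w := by
  rw [div_sub' hd.ne', abs_div, abs_of_pos hd]
  exact (div_le_iff₀' hd).mpr h

/-- Taylor expansion of the symmetric difference quotient. -/
theorem abs_symm_diff_sub_sum_le {f : ℝ → ℝ} {a b K x h : ℝ} {p : ℕ} (hh : 0 < h)
    (hf : ContDiffOn ℝ (2 * p + 1 : ℕ) f (Icc a b)) (ha : x - h ∈ Icc a b) (hb : x + h ∈ Icc a b)
    (hK : ∀ z ∈ Icc a b, |iteratedDerivWithin (2 * p + 1) f (Icc a b) z| ≤ K) :
    |(f (x + h) - f (x - h)) / (2 * h) - ∑ m ∈ Finset.range p,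
      (((2 * m + 1).factorial : ℝ)⁻¹ * iteratedDerivWithin (2 * m + 1) f (Icc a b) x) *
        h ^ (2 * m)| ≤ K / (2 * p).factorial * h ^ (2 * p) := by
  have hab : a < b := by linarith [ha.1, hb.2]
  have hx : x ∈ Icc a b := ⟨by linarith [ha.1], by linarith [hb.2]⟩
  have h1 := abs_sub_taylorWithinEval_le hab hf hx hb hK
  have h2 := abs_sub_taylorWithinEval_le hab hf hx ha hK
  rw [taylorWithinEval_eq_sum_mul_pow] at h1 h2
  simp only [add_sub_cancel_left, sub_sub_cancel_left, abs_neg, abs_of_pos hh] at h1 h2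
  have hodd := sum_range_odd_part (fun k => ((k.factorial : ℝ)⁻¹ *
    iteratedDerivWithin k f (Icc a b) x)) h p
  have h3 := (abs_sub _ _).trans (add_le_add h1 h2)
  rw [sub_sub_sub_comm, hodd] at h3
  exact abs_div_sub_le (by positivity) (h3.trans_eq (by ring))

/-- Taylor expansion of the symmetric second difference quotient. -/
theorem abs_symm_second_diff_sub_sum_le {f : ℝ → ℝ} {a b K x h : ℝ} {p : ℕ} (hh : 0 < h)
    (hf : ContDiffOn ℝ (2 * p + 2 : ℕ) f (Icc a b)) (ha : x - h ∈ Icc a b) (hb : x + h ∈ Icc a b)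
    (hK : ∀ z ∈ Icc a b, |iteratedDerivWithin (2 * p + 2) f (Icc a b) z| ≤ K) :
    |(f (x + h) + f (x - h) - 2 * f x) / h ^ 2 - ∑ m ∈ Finset.range p,
      2 * (((2 * m + 2).factorial : ℝ)⁻¹ * iteratedDerivWithin (2 * m + 2) f (Icc a b) x) *
        h ^ (2 * m)| ≤ 2 * K / (2 * p + 1).factorial * h ^ (2 * p) := by
  have hab : a < b := by linarith [ha.1, hb.2]
  have hx : x ∈ Icc a b := ⟨by linarith [ha.1], by linarith [hb.2]⟩
  have h1 := abs_sub_taylorWithinEval_le hab hf hx hb hK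
  have h2 := abs_sub_taylorWithinEval_le hab hf hx ha hK
  rw [taylorWithinEval_eq_sum_mul_pow] at h1 h2
  simp only [add_sub_cancel_left, sub_sub_cancel_left, abs_neg, abs_of_pos hh] at h1 h2
  have heven := sum_range_even_part (fun k => ((k.factorial : ℝ)⁻¹ *
    iteratedDerivWithin k f (Icc a b) x)) h p
  have h3 := (abs_add_le _ _).trans (add_le_add h1 h2)
  rw [sub_add_sub_comm, heven] at h3
  simp only [Nat.factorial_zero, Nat.cast_one, inv_one, one_mul, iteratedDerivWithin_zero,
    ← sub_sub] at h3
  exact abs_div_sub_le (by positivity) (h3.trans_eq (by ring))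

/-- Order-`2p` accuracy of the symmetric finite-difference operators
`D_{2p} = Σ_{j=1}^p α_j δ_{2j}` and `D^{(2)}_{2p} = Σ_{j=1}^p α_j δ_j²`. -/
theorem fd_operator_accuracy (p : ℕ) (hp : 1 ≤ p) :
    ∃ C C' : ℝ, ∀ Δx : ℝ, 0 < Δx → ∀ (f g : ℝ → ℝ) (x : ℝ),
      ContDiffOn ℝ (2 * p + 1 : ℕ) f (Icc (x - p * Δx) (x + p * Δx)) →
      ContDiffOn ℝ (2 * p + 2 : ℕ) g (Icc (x - p * Δx) (x + p * Δx)) →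
      ∀ K K' : ℝ,
        (∀ y ∈ Icc (x - p * Δx) (x + p * Δx),
          |iteratedDerivWithin (2 * p + 1) f (Icc (x - p * Δx) (x + p * Δx)) y| ≤ K) →
        (∀ y ∈ Icc (x - p * Δx) (x + p * Δx),
          |iteratedDerivWithin (2 * p + 2) g (Icc (x - p * Δx) (x + p * Δx)) y| ≤ K') →
        |derivWithin f (Icc (x - p * Δx) (x + p * Δx)) x -
            ∑ j ∈ Finset.Icc 1 p, fdAlpha p j * fdDelta Δx (2 * j) f x| ≤
          C * K * Δx ^ (2 * p) ∧
        |iteratedDerivWithin 2 g (Icc (x - p * Δx) (x + p * Δx)) x -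
            ∑ j ∈ Finset.Icc 1 p, fdAlpha p j * fdDelta Δx j (fdDelta Δx j g) x| ≤
          C' * K' * Δx ^ (2 * p) := by
  set S : ℝ := ∑ j ∈ Finset.Icc 1 p, |fdAlpha p j| * (j : ℝ) ^ (2 * p)
  refine ⟨S / (2 * p).factorial, S * 2 / (2 * p + 1).factorial, ?_⟩
  intro Δx hΔ f g x hf hg K K' hK hK'
  have hpos (j : ℕ) (hj : j ∈ Finset.Icc 1 p) : 0 < j * Δx :=
    mul_pos (by exact_mod_cast (Finset.mem_Icc.mp hj).1) hΔ
  have hle (j : ℕ) (hj : j ∈ Finset.Icc 1 p) : j * Δx ≤ p * Δx :=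
    mul_le_mul_of_nonneg_right (by exact_mod_cast (Finset.mem_Icc.mp hj).2) hΔ.le
  have hl (j : ℕ) (hj : j ∈ Finset.Icc 1 p) :
      x - j * Δx ∈ Icc (x - p * Δx) (x + p * Δx) :=
    ⟨by linarith [hle j hj], by linarith [hpos j hj, hle j hj]⟩
  have hr (j : ℕ) (hj : j ∈ Finset.Icc 1 p) :
      x + j * Δx ∈ Icc (x - p * Δx) (x + p * Δx) :=
    ⟨by linarith [hpos j hj, hle j hj], by linarith [hle j hj]⟩
  constructor
  · have := abs_sub_sum_fdAlpha_mul_le hp fun j hj =>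
      abs_symm_diff_sub_sum_le (hpos j hj) hf (hl j hj) (hr j hj) hK
    simp only [fdDelta_two_mul]
    simp only [mul_zero, zero_add, Nat.factorial_one, Nat.cast_one, inv_one, one_mul,
      iteratedDerivWithin_one] at this
    exact this.trans_eq (by ring)
  · have := abs_sub_sum_fdAlpha_mul_le hp fun j hj =>
      abs_symm_second_diff_sub_sum_le (hpos j hj) hg (hl j hj) (hr j hj) hK'
    simp only [fdDelta_fdDelta]
    simp only [mul_zero, zero_add, Nat.factorial_two, Nat.cast_ofNat, ← mul_assoc,
      mul_inv_cancel₀ (two_ne_zero' ℝ), one_mul] at this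
    exact this.trans_eq (by ring)
end

section
/- Let H_n = ℂ^{2^n}, let Π : H_n → H_n be an orthogonal projection, and let U, V : H_n → H_n be unitaries. Set A = Π U Π and B = Π V Π (regarded as operators on Im Π). Define W : ℂ² ⊗ H_n → ℂ² ⊗ H_n by W = (X ⊗ U) ∘ C_Π NOT ∘ (I₂ ⊗ V), where X is the Pauli-X gate and C_Π NOT = X ⊗ Π + I₂ ⊗ (I − Π). Then for every ψ ∈ Im Π, the orthogonal projection of W(|0⟩ ⊗ ψ) onto the subspace |0⟩ ⊗ Im Π equals |0⟩ ⊗ (A B ψ). In other words, W is a unitary block encoding of the composition AB on the subspace |0⟩ ⊗ Im Π. -/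
open Matrix Kronecker

/-- The Pauli-X gate on ℂ². -/
noncomputable def pauliX : Matrix (Fin 2) (Fin 2) ℂ := !![0, 1; 1, 0]

/-- The projector `|0⟩⟨0|` on ℂ². -/
noncomputable def proj0 : Matrix (Fin 2) (Fin 2) ℂ := !![1, 0; 0, 0]

/-- A Kronecker product acts on `|0⟩ ⊗ v` through the zeroth column of its left factor. -/
theorem kronecker_mulVec_ket_zero {R m : Type*} [CommSemiring R] [Fintype m]
    (A : Matrix (Fin 2) (Fin 2) R) (B : Matrix m m R) (v : m → R) :
    (A ⊗ₖ B).mulVec (fun q => if q.1 = 0 then v q.2 else 0) =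
      fun q => A q.1 0 * B.mulVec v q.2 := by
  ext q
  simp [mulVec, dotProduct, Fintype.sum_prod_type, Finset.mul_sum, mul_assoc]

/-- Composition of block encodings: with `A = ΠUΠ`, `B = ΠVΠ` and
`W = (X ⊗ U) ∘ C_Π NOT ∘ (I₂ ⊗ V)`, the orthogonal projection of `W(|0⟩ ⊗ ψ)` onto the
subspace `|0⟩ ⊗ Im Π` equals `|0⟩ ⊗ (A B ψ)` for every `ψ ∈ Im Π`; i.e. `W` is a unitary
block encoding of the composition `AB` on `|0⟩ ⊗ Im Π`. -/
theorem block_encoding_composition (n : ℕ)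
    (P U V : Matrix (Fin (2 ^ n)) (Fin (2 ^ n)) ℂ)
    (hP : P.IsHermitian) (hPP : P * P = P)
    (hU : U ∈ Matrix.unitaryGroup (Fin (2 ^ n)) ℂ)
    (hV : V ∈ Matrix.unitaryGroup (Fin (2 ^ n)) ℂ)
    (W : Matrix (Fin 2 × Fin (2 ^ n)) (Fin 2 × Fin (2 ^ n)) ℂ)
    (hW : W = (pauliX ⊗ₖ U) * (pauliX ⊗ₖ P + 1 ⊗ₖ (1 - P)) * (1 ⊗ₖ V))
    (ψ : Fin (2 ^ n) → ℂ) (hψ : P.mulVec ψ = ψ) :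
    (proj0 ⊗ₖ P).mulVec (W.mulVec (fun q => if q.1 = 0 then ψ q.2 else 0)) =
      (fun q => if q.1 = 0 then ((P * U * P) * (P * V * P)).mulVec ψ q.2 else 0) := by
  have hW_mul : (proj0 ⊗ₖ P) * W = (proj0 * pauliX * pauliX) ⊗ₖ (P * U * P * V) +
      (proj0 * pauliX) ⊗ₖ (P * U * (1 - P) * V) := by
    simp only [hW, mul_add, add_mul, ← Matrix.mul_assoc, ← mul_kronecker_mul, Matrix.mul_one]
  have hB : (P * V * P).mulVec ψ = (P * V).mulVec ψ := by
    rw [← mulVec_mulVec, hψ]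
  have hAB : ((P * U * P) * (P * V * P)).mulVec ψ = (P * U * P * V).mulVec ψ := by
    rw [← mulVec_mulVec, hB, mulVec_mulVec, ← Matrix.mul_assoc, Matrix.mul_assoc (P * U), hPP]
  rw [mulVec_mulVec, hW_mul, add_mulVec, kronecker_mulVec_ket_zero, kronecker_mulVec_ket_zero,
    hAB]
  ext ⟨i, j⟩
  fin_cases i <;> simp [proj0, pauliX]
end

section
/- Let p ≥ 1 be an integer, m = ⌈log₂(2p+1)⌉, and n ≥ m. Let T be the cyclic shift on ℂ^{2^n} (T|k⟩ = |k+1 mod 2^n⟩), Δx > 0, and D_{2p} = Σ_{j=1}^p (α_j/(2jΔx))(T^j − T^{−j}) acting on ℂ^{2^n}, where α_j = 2(−1)^{j+1}(p!)²/((p+j)!(p−j)!). Let c_p be defined by c_p^{−1} = Σ_{j=1}^p |α_j|/j, and let S_L, S_R be any unitaries on ℂ^{2^m} satisfying S_L|0⟩ = i√(c_p) Σ_{j=1}^p (|α_j|/(2j))^{1/2} (|p+j⟩ + |p−j⟩) and S_R|0⟩ = √(c_p) Σ_{j=1}^p (−1)^{j+1} (|α_j|/(2j))^{1/2} (|p+j⟩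 − |p−j⟩). Let M_{m,n,−p} be the modular adder on ℂ^{2^m} ⊗ ℂ^{2^n} given by M_{m,n,−p}|j⟩|k⟩ = |j⟩|k + j − p mod 2^n⟩. Then (⟨0| ⊗ I)(S_R^† ⊗ I) M_{m,n,−p} (S_L ⊗ I)(|0⟩ ⊗ I) = i (c_p Δx) D_{2p}; that is, the circuit (S_R^† ⊗ I) M_{m,n,−p} (S_L ⊗ I) is a unitary block encoding of the Hermitian matrix H = i(c_p Δx) D_{2p} on the subspace |0⟩ ⊗ ℂ^{2^n}. -/
open Matrix Kronecker Complex

/-- The normalizing constant `c_p`, defined by `c_p⁻¹ = Σ_{j=1}^p |α_j|/j`. -/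
noncomputable def fdCp (p : ℕ) : ℝ := (∑ j ∈ Finset.Icc 1 p, |fdAlpha p j| / j)⁻¹

/-- The cyclic shift `T|k⟩ = |k+1 mod N⟩` on ℂ^N. -/
noncomputable def shiftT (N : ℕ) [NeZero N] : Matrix (ZMod N) (ZMod N) ℂ :=
  Matrix.of fun k l => if k = l + 1 then 1 else 0

/-- The modular adder `M_{m,n,l}|j⟩|k⟩ = |j⟩|k + j + l mod 2^n⟩`. -/
noncomputable def modAdder (m n : ℕ) (l : ℤ) :
    Matrix (ZMod (2 ^ m) × ZMod (2 ^ n)) (ZMod (2 ^ m) × ZMod (2 ^ n)) ℂ :=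
  Matrix.of fun q q' =>
    if q.1 = q'.1 ∧ q.2 = q'.2 + (q'.1.val : ZMod (2 ^ n)) + (l : ZMod (2 ^ n)) then 1 else 0

lemma shiftT_pow_apply (N : ℕ) [NeZero N] (j : ℕ) (k l : ZMod N) :
    (shiftT N ^ j) k l = if k = l + j then 1 else 0 := by
  induction j generalizing k l with
  | zero => simp [Matrix.one_apply]
  | succ j ih =>
    rw [pow_succ, Matrix.mul_apply]
    simp_rw [ih, shiftT, Matrix.of_apply]
    simp [add_assoc, add_comm (1 : ZMod N)]

lemma shiftT_mul_transpose (N : ℕ) [NeZero N] : shiftT N * (shiftT N)ᵀ = 1 := by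
  ext k l
  simp only [Matrix.mul_apply, Matrix.transpose_apply, shiftT, Matrix.of_apply, Matrix.one_apply]
  simp_rw [← sub_eq_iff_eq_add]
  simp

lemma shiftT_inv_pow_apply (N : ℕ) [NeZero N] (j : ℕ) (k l : ZMod N) :
    ((shiftT N)⁻¹ ^ j) k l = if k = l - j then 1 else 0 := by
  rw [Matrix.inv_eq_right_inv (shiftT_mul_transpose N), ← Matrix.transpose_pow,
    Matrix.transpose_apply, shiftT_pow_apply]
  simp only [eq_sub_iff_add_eq, eq_comm (a := l)]

lemma zmod_eq_natCast_iff {N : ℕ} [NeZero N] (j : ZMod N) {a : ℕ} (ha : a < N) :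
    j = (a : ZMod N) ↔ j.val = a := by
  constructor
  · rintro rfl
    exact ZMod.val_cast_of_lt ha
  · rintro rfl
    exact (ZMod.natCast_zmod_val j).symm

/-- Sums over the reflected pairs of indicators at `p + i` and `p - i` multiply diagonally. -/
lemma sum_odd_mul_sum_even {N : ℕ} [NeZero N] {p : ℕ} (hp : 2 * p < N) (j : ZMod N)
    (a b : ℕ → ℂ) :
    (∑ i ∈ Finset.Icc 1 p, a i * ((if j = ((p + i : ℕ) : ZMod N) then 1 else 0) -
        (if j = ((p - i : ℕ) : ZMod N) then 1 else 0))) *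
      (∑ i ∈ Finset.Icc 1 p, b i * ((if j = ((p + i : ℕ) : ZMod N) then 1 else 0) +
        (if j = ((p - i : ℕ) : ZMod N) then 1 else 0))) =
    ∑ i ∈ Finset.Icc 1 p, a i * b i * ((if j = ((p + i : ℕ) : ZMod N) then 1 else 0) -
        (if j = ((p - i : ℕ) : ZMod N) then 1 else 0)) := by
  have hadd : ∀ i ∈ Finset.Icc 1 p, (j = ((p + i : ℕ) : ZMod N) ↔ j.val = p + i) :=
    fun i hi => zmod_eq_natCast_iff j (by rw [Finset.mem_Icc] at hi; omega)
  have hsub : ∀ i, (j = ((p - i : ℕ) : ZMod N) ↔ j.val = p - i) :=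
    fun i => zmod_eq_natCast_iff j (by omega)
  rw [Finset.sum_mul_sum]
  refine Finset.sum_congr rfl fun i hi => ?_
  rw [Finset.sum_eq_single_of_mem i hi]
  · simp only [hadd i hi, hsub]
    rw [Finset.mem_Icc] at hi
    split_ifs <;> first | omega | ring
  · intro i' hi' hne
    simp only [hadd i hi, hadd i' hi', hsub]
    rw [Finset.mem_Icc] at hi hi'
    split_ifs <;> first | omega | ring

lemma fdAlpha_eq_sign_mul_abs (p j : ℕ) :
    fdAlpha p j = (-1) ^ (j + 1) * |fdAlpha p j| := by
  have h : |fdAlpha p j| = 2 * (p.factorial : ℝ) ^ 2 / ((p + j).factorial * (p - j).factorial) := by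
    rw [fdAlpha, abs_div, abs_mul, abs_mul, abs_pow, abs_neg, abs_one, one_pow, mul_one,
      abs_of_pos (by norm_num : (0 : ℝ) < 2),
      abs_of_nonneg (by positivity : (0 : ℝ) ≤ (p.factorial : ℝ) ^ 2), abs_of_nonneg (by positivity)]
  rw [h, fdAlpha]
  ring

lemma fdCp_nonneg (p : ℕ) : 0 ≤ fdCp p :=
  inv_nonneg.2 (Finset.sum_nonneg fun _ _ => by positivity)

lemma sign_mul_sqrt_mul_sqrt (p i : ℕ) :
    (-1 : ℂ) ^ (i + 1) * ((Real.sqrt (|fdAlpha p i| / (2 * i)) : ℝ) : ℂ) *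
      ((Real.sqrt (|fdAlpha p i| / (2 * i)) : ℝ) : ℂ) = ((fdAlpha p i / (2 * i) : ℝ) : ℂ) := by
  rw [mul_assoc, ← Complex.ofReal_mul, Real.mul_self_sqrt (by positivity)]
  conv_rhs => rw [fdAlpha_eq_sign_mul_abs]
  push_cast
  ring

/-- A select operator `∑ j, |j⟩⟨j| ⊗ U_j` sandwiched between two state preparations. -/
lemma kronecker_modAdder_apply (m n : ℕ) (l : ℤ) (A B : Matrix (ZMod (2 ^ m)) (ZMod (2 ^ m)) ℂ)
    (k k' : ZMod (2 ^ n)) :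
    ((A.conjTranspose ⊗ₖ (1 : Matrix (ZMod (2 ^ n)) (ZMod (2 ^ n)) ℂ)) * modAdder m n l *
        (B ⊗ₖ (1 : Matrix (ZMod (2 ^ n)) (ZMod (2 ^ n)) ℂ))) (0, k) (0, k') =
      ∑ j : ZMod (2 ^ m), star (A j 0) * B j 0 *
        (if k = k' + (j.val : ZMod (2 ^ n)) + (l : ZMod (2 ^ n)) then 1 else 0) := by
  simp only [Matrix.mul_apply, Fintype.sum_prod_type, Matrix.kroneckerMap_apply, Matrix.one_apply,
    modAdder, Matrix.of_apply, Matrix.conjTranspose_apply, ite_and, mul_ite, mul_one, mul_zero,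
    Finset.sum_ite_eq', Finset.mem_univ, if_true]
  refine Finset.sum_congr rfl fun j _ => ?_
  simp

/-- The circuit `(S_R^† ⊗ I) M_{m,n,−p} (S_L ⊗ I)` is a unitary block encoding of the
Hermitian matrix `H = i(c_p Δx) D_{2p}` on the subspace `|0⟩ ⊗ ℂ^{2^n}`. -/
theorem block_encoding_D2p (p : ℕ) (hp : 1 ≤ p) (m n : ℕ)
    (hm : m = Nat.clog 2 (2 * p + 1)) (hnm : m ≤ n) (Δx : ℝ) (hΔx : 0 < Δx)
    (D2p : Matrix (ZMod (2 ^ n)) (ZMod (2 ^ n)) ℂ)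
    (hD2p : D2p = ∑ j ∈ Finset.Icc 1 p,
      ((fdAlpha p j / (2 * j * Δx) : ℝ) : ℂ) •
        ((shiftT (2 ^ n)) ^ j - ((shiftT (2 ^ n))⁻¹) ^ j))
    (SL SR : Matrix (ZMod (2 ^ m)) (ZMod (2 ^ m)) ℂ)
    (hSL : SL ∈ Matrix.unitaryGroup (ZMod (2 ^ m)) ℂ)
    (hSR : SR ∈ Matrix.unitaryGroup (ZMod (2 ^ m)) ℂ)
    (hSL0 : ∀ j : ZMod (2 ^ m), SL j 0 =
      Complex.I * (Real.sqrt (fdCp p) : ℝ) *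
        ∑ i ∈ Finset.Icc 1 p, ((Real.sqrt (|fdAlpha p i| / (2 * i)) : ℝ) : ℂ) *
          ((if j = ((p + i : ℕ) : ZMod (2 ^ m)) then 1 else 0) +
           (if j = ((p - i : ℕ) : ZMod (2 ^ m)) then 1 else 0)))
    (hSR0 : ∀ j : ZMod (2 ^ m), SR j 0 =
      ((Real.sqrt (fdCp p) : ℝ) : ℂ) *
        ∑ i ∈ Finset.Icc 1 p, (-1 : ℂ) ^ (i + 1) *
          ((Real.sqrt (|fdAlpha p i| / (2 * i)) : ℝ) : ℂ) *
          ((if j = ((p + i : ℕ) : ZMod (2 ^ m)) then 1 else 0) -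
           (if j = ((p - i : ℕ) : ZMod (2 ^ m)) then 1 else 0))) :
    ∀ k k' : ZMod (2 ^ n),
      ((SR.conjTranspose ⊗ₖ (1 : Matrix (ZMod (2 ^ n)) (ZMod (2 ^ n)) ℂ)) *
          modAdder m n (-(p : ℤ)) *
          (SL ⊗ₖ (1 : Matrix (ZMod (2 ^ n)) (ZMod (2 ^ n)) ℂ)))
        ((0 : ZMod (2 ^ m)), k) ((0 : ZMod (2 ^ m)), k') =
      Complex.I * ((fdCp p * Δx : ℝ) : ℂ) * D2p k k' := by
  intro k k'
  have hlt : 2 * p < 2 ^ m := by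
    rw [hm]
    exact Nat.lt_of_succ_le (Nat.le_pow_clog (by norm_num) _)
  have hprod : ∀ j : ZMod (2 ^ m), star (SR j 0) * SL j 0 =
      Complex.I * (fdCp p : ℂ) * ∑ i ∈ Finset.Icc 1 p, ((fdAlpha p i / (2 * i) : ℝ) : ℂ) *
        ((if j = ((p + i : ℕ) : ZMod (2 ^ m)) then 1 else 0) -
          (if j = ((p - i : ℕ) : ZMod (2 ^ m)) then 1 else 0)) := by
    intro j
    have hstar : star (SR j 0) = SR j 0 := by
      rw [hSR0]
      simp [apply_ite (starRingEnd ℂ)]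
    have hc : ((Real.sqrt (fdCp p) : ℝ) : ℂ) * ((Real.sqrt (fdCp p) : ℝ) : ℂ) = (fdCp p : ℂ) := by
      rw [← Complex.ofReal_mul, Real.mul_self_sqrt (fdCp_nonneg p)]
    rw [hstar, hSR0, hSL0, ← hc]
    have hsum := sum_odd_mul_sum_even hlt j
      (fun i => (-1 : ℂ) ^ (i + 1) * ((Real.sqrt (|fdAlpha p i| / (2 * i)) : ℝ) : ℂ))
      (fun i => ((Real.sqrt (|fdAlpha p i| / (2 * i)) : ℝ) : ℂ))
    simp only [sign_mul_sqrt_mul_sqrt] at hsum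
    rw [← hsum]
    ring
  rw [kronecker_modAdder_apply, hD2p]
  simp_rw [hprod, Finset.mul_sum, Finset.sum_mul]
  rw [Finset.sum_comm, Matrix.sum_apply, Finset.mul_sum]
  refine Finset.sum_congr rfl fun i hi => ?_
  rw [Finset.mem_Icc] at hi
  rw [Matrix.smul_apply, Matrix.sub_apply, shiftT_pow_apply, shiftT_inv_pow_apply, smul_eq_mul]
  have hshift : ∀ (a : ℕ) (c : ℂ), a < 2 ^ m →
      ∑ j : ZMod (2 ^ m), c * (if j = (a : ZMod (2 ^ m)) then 1 else 0) *
        (if k = k' + (j.val : ZMod (2 ^ n)) + ((-(p : ℤ) : ℤ) : ZMod (2 ^ n)) then 1 else 0) =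
      c * (if k = k' + (a : ZMod (2 ^ n)) - p then 1 else 0) := by
    intro a c ha
    rw [Finset.sum_eq_single (a : ZMod (2 ^ m))]
    · simp [ZMod.val_cast_of_lt ha, sub_eq_add_neg]
    · intro j _ hj
      simp [hj]
    · simp
  have hi0 : (i : ℂ) ≠ 0 := by exact_mod_cast (by omega : i ≠ 0)
  have hΔ : (Δx : ℂ) ≠ 0 := by exact_mod_cast hΔx.ne'
  simp_rw [mul_sub, sub_mul, Finset.sum_sub_distrib, ← mul_assoc]
  rw [hshift _ _ (by omega), hshift _ _ (by omega), Nat.cast_add, Nat.cast_sub hi.2,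
    show k' + ((p : ZMod (2 ^ n)) + i) - p = k' + i by ring,
    show k' + ((p : ZMod (2 ^ n)) - i) - p = k' - i by ring]
  push_cast
  field_simp
end

section
/- Let M > 0 and ε ∈ (0,1), and let R = ⌊r(eM/2, 5ε/4)/2⌋, where r(t, ε') denotes the unique real number r > t satisfying (t/r)^r = ε'. Define the truncated Jacobi–Anger expansions C_R(x; M) = J_0(M) + 2 Σ_{k=1}^R (−1)^k J_{2k}(M) T_{2k}(x) and S_R(x; M) = 2 Σ_{k=0}^R (−1)^k J_{2k+1}(M) T_{2k+1}(x), where J_n is the Bessel function of the first kind and T_n the n-th Chebyshev polynomial of the first kind. Then |C_R(x; M) − cos(Mx)| ≤ ε and |S_R(x; M) − sin(Mx)| ≤ ε for all x ∈ [−1,1]. -/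
open Real Polynomial

/-- The Bessel function of the first kind `J_n(x) = Σ_k (−1)^k (x/2)^{n+2k}/(k!(n+k)!)`. -/
noncomputable def besselJ (n : ℕ) (x : ℝ) : ℝ :=
  ∑' k : ℕ, (-1 : ℝ) ^ k * (x / 2) ^ (n + 2 * k) / (k.factorial * (n + k).factorial)

/-- The degree-`2R` truncated Jacobi–Anger expansion of `cos(Mx)`:
`C_R(x; M) = J_0(M) + 2 Σ_{k=1}^R (−1)^k J_{2k}(M) T_{2k}(x)`. -/
noncomputable def jaCos (R : ℕ) (M x : ℝ) : ℝ :=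
  besselJ 0 M + 2 * ∑ k ∈ Finset.Icc 1 R,
    (-1 : ℝ) ^ k * besselJ (2 * k) M * (Chebyshev.T ℝ (2 * k : ℤ)).eval x

/-- The degree-`2R+1` truncated Jacobi–Anger expansion of `sin(Mx)`:
`S_R(x; M) = 2 Σ_{k=0}^R (−1)^k J_{2k+1}(M) T_{2k+1}(x)`. -/
noncomputable def jaSin (R : ℕ) (M x : ℝ) : ℝ :=
  2 * ∑ k ∈ Finset.range (R + 1),
    (-1 : ℝ) ^ k * besselJ (2 * k + 1) M * (Chebyshev.T ℝ (2 * k + 1 : ℤ)).eval x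

/-- The entire function `B_n(y) = Σ_k (−y)^k/(k!(n+k)!)`, for which `J_n(x) = (x/2)^n B_n(x²/4)`. -/
noncomputable def besselClifford (n : ℕ) (y : ℝ) : ℝ :=
  ∑' k : ℕ, (-1 : ℝ) ^ k * y ^ k / (k.factorial * (n + k).factorial)

lemma norm_besselClifford_term_le (n k : ℕ) (y : ℝ) :
    ‖(-1 : ℝ) ^ k * y ^ k / (k.factorial * (n + k).factorial)‖ ≤ |y| ^ k / k.factorial := by
  have h1 : (1 : ℝ) ≤ (n + k).factorial := by exact_mod_cast Nat.factorial_pos _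
  have h2 : (0 : ℝ) < k.factorial := by exact_mod_cast Nat.factorial_pos _
  rw [norm_div, norm_mul, norm_pow, norm_pow, norm_neg, norm_one, one_pow, one_mul,
    Real.norm_eq_abs, Real.norm_of_nonneg (by positivity)]
  gcongr
  nlinarith

lemma summable_besselClifford (n : ℕ) (y : ℝ) :
    Summable fun k : ℕ => (-1 : ℝ) ^ k * y ^ k / (k.factorial * (n + k).factorial) :=
  .of_norm_bounded (Real.summable_pow_div_factorial |y|)
    fun k => norm_besselClifford_term_le n k y

lemma besselClifford_zero (n : ℕ) : besselClifford n 0 = 1 / n.factorial := by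
  rw [besselClifford, tsum_eq_single 0 (by intro k hk; simp [hk])]
  simp

lemma besselClifford_deriv_term (n k : ℕ) (y : ℝ) :
    (-1 : ℝ) ^ (k + 1) * ((k + 1 : ℕ) * y ^ k) / ((k + 1).factorial * (n + (k + 1)).factorial) =
      -((-1 : ℝ) ^ k * y ^ k / (k.factorial * (n + 1 + k).factorial)) := by
  have h : (k.factorial : ℝ) ≠ 0 := by exact_mod_cast k.factorial_ne_zero
  have h' : ((n + 1 + k).factorial : ℝ) ≠ 0 := by exact_mod_cast Nat.factorial_ne_zero _
  rw [show n + (k + 1) = n + 1 + k by ring, Nat.factorial_succ k]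
  push_cast
  field_simp
  ring

lemma hasDerivAt_besselClifford (n : ℕ) (y : ℝ) :
    HasDerivAt (besselClifford n) (-besselClifford (n + 1) y) y := by
  set g' : ℕ → ℝ → ℝ := fun k z =>
    (-1 : ℝ) ^ k * (k * z ^ (k - 1)) / (k.factorial * (n + k).factorial) with hg'
  have hsucc (k : ℕ) (z : ℝ) : g' (k + 1) z =
      -((-1 : ℝ) ^ k * z ^ k / (k.factorial * (n + 1 + k).factorial)) := by
    simpa [hg'] using besselClifford_deriv_term n k z
  have hzero (z : ℝ) : g' 0 z = 0 := by simp [hg']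
  set ρ : ℝ := |y| + 1 with hρ
  have hρ0 : 0 < ρ := by positivity
  let u : ℕ → ℝ := fun k => ρ ^ (k - 1) / (k - 1).factorial
  have hu : Summable u :=
    (summable_nat_add_iff 1).1 (by simpa [u] using Real.summable_pow_div_factorial ρ)
  have key := hasDerivAt_tsum_of_isPreconnected (𝕜 := ℝ) (t := Metric.ball (0 : ℝ) ρ)
    (g := fun k z => (-1 : ℝ) ^ k * z ^ k / (k.factorial * (n + k).factorial)) (g' := g')
    (y₀ := 0) (y := y) hu Metric.isOpen_ball (convex_ball 0 ρ).isPreconnected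
    (fun k z _ => ((hasDerivAt_pow k z).const_mul _).div_const _)
    (by
      rintro (_ | k) z hz
      · rw [hzero]; simp [u]
      · rw [hsucc, norm_neg]
        refine (norm_besselClifford_term_le (n + 1) k z).trans ?_
        have : |z| ≤ ρ := by simpa using (mem_ball_zero_iff.1 hz).le
        simp only [u, Nat.add_sub_cancel]
        gcongr)
    (Metric.mem_ball_self hρ0) (summable_besselClifford n 0)
    (by simp [hρ])
  have hs : Summable fun k => g' k y :=
    (summable_nat_add_iff 1).1 (by simpa only [hsucc] using
      (summable_besselClifford (n + 1) y).neg)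
  have hval : ∑' k, g' k y = -besselClifford (n + 1) y := by
    rw [hs.tsum_eq_zero_add, hzero, zero_add]
    simp only [hsucc]
    rw [tsum_neg, besselClifford]
  rw [hval] at key
  exact key

lemma besselClifford_recurrence (n : ℕ) (y : ℝ) :
    y * besselClifford (n + 2) y = (n + 1) * besselClifford (n + 1) y - besselClifford n y := by
  have h1 := (summable_besselClifford (n + 1) y).hasSum.mul_left ((n : ℝ) + 1)
  have h2 := h1.sub (summable_besselClifford n y).hasSum
  have h3 := (summable_besselClifford (n + 2) y).hasSum.mul_left y
  refine h3.unique ?_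
  have hz : ((n : ℝ) + 1) * ((-1 : ℝ) ^ 0 * y ^ 0 / ((0 : ℕ).factorial * (n + 1 + 0).factorial)) -
      (-1 : ℝ) ^ 0 * y ^ 0 / ((0 : ℕ).factorial * (n + 0).factorial) = 0 := by
    have h : (n.factorial : ℝ) ≠ 0 := by exact_mod_cast n.factorial_ne_zero
    have h' : (n : ℝ) + 1 ≠ 0 := by positivity
    simp only [add_zero, Nat.factorial_succ]
    push_cast
    field_simp
    simp
  have h4 := (hasSum_nat_add_iff' 1).2 h2
  rw [Finset.sum_range_one, hz, sub_zero] at h4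
  have hterm (k : ℕ) : y * ((-1 : ℝ) ^ k * y ^ k / (k.factorial * (n + 2 + k).factorial)) =
      (n + 1) * ((-1 : ℝ) ^ (k + 1) * y ^ (k + 1) /
        ((k + 1).factorial * (n + 1 + (k + 1)).factorial)) -
      (-1 : ℝ) ^ (k + 1) * y ^ (k + 1) / ((k + 1).factorial * (n + (k + 1)).factorial) := by
    have h : (k.factorial : ℝ) ≠ 0 := by exact_mod_cast k.factorial_ne_zero
    have h' : ((n + 1 + k).factorial : ℝ) ≠ 0 := by exact_mod_cast Nat.factorial_ne_zero _
    have h5 : (n : ℝ) + 1 + k + 1 ≠ 0 := by positivity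
    have h6 : (k : ℝ) + 1 ≠ 0 := by positivity
    rw [show n + 2 + k = n + 1 + k + 1 by ring, show n + 1 + (k + 1) = n + 1 + k + 1 by ring,
      show n + (k + 1) = n + 1 + k by ring, Nat.factorial_succ k, Nat.factorial_succ (n + 1 + k)]
    push_cast
    field_simp
    ring
  simp only [hterm]
  exact h4

lemma abs_besselClifford_le (n : ℕ) {y : ℝ} (hy : 0 ≤ y) :
    |besselClifford n y| ≤ 1 / n.factorial := by
  let E : ℝ → ℝ := fun z => besselClifford n z ^ 2 + z * besselClifford (n + 1) z ^ 2
  have hE (z : ℝ) : HasDerivAt E (-((2 * n + 1) * besselClifford (n + 1) z ^ 2)) z := by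
    have h0 := (hasDerivAt_besselClifford n z).pow 2
    have h1 := (hasDerivAt_id z).mul ((hasDerivAt_besselClifford (n + 1) z).pow 2)
    refine (h0.add h1).congr_deriv ?_
    have := besselClifford_recurrence n z
    simp only [id, Pi.pow_apply]
    push_cast
    linear_combination (-2 * besselClifford (n + 1) z) * this
  have hanti : Antitone E := by
    refine antitone_of_deriv_nonpos (fun z => (hE z).differentiableAt) fun z => ?_
    rw [(hE z).deriv, neg_nonpos]
    positivity
  have h := hanti hy
  simp only [E, besselClifford_zero, zero_mul, add_zero] at h
  refine abs_le_of_sq_le_sq ?_ (by positivity)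
  nlinarith [mul_nonneg hy (sq_nonneg (besselClifford (n + 1) y))]

lemma besselJ_term (n k : ℕ) (x : ℝ) :
    (-1 : ℝ) ^ k * (x / 2) ^ (n + 2 * k) / (k.factorial * (n + k).factorial) =
      (x / 2) ^ n * ((-1 : ℝ) ^ k * (x ^ 2 / 4) ^ k / (k.factorial * (n + k).factorial)) := by
  rw [pow_add, pow_mul, show x ^ 2 / 4 = (x / 2) ^ 2 by ring]
  ring

lemma hasSum_besselJ (n : ℕ) (x : ℝ) :
    HasSum (fun k : ℕ => (-1 : ℝ) ^ k * (x / 2) ^ (n + 2 * k) / (k.factorial * (n + k).factorial))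
      (besselJ n x) := by
  refine Summable.hasSum ?_
  simp only [besselJ_term]
  exact (summable_besselClifford n _).mul_left _

lemma abs_besselJ_le (n : ℕ) {x : ℝ} (hx : 0 ≤ x) :
    |besselJ n x| ≤ (x / 2) ^ n / n.factorial := by
  have h : besselJ n x = (x / 2) ^ n * besselClifford n (x ^ 2 / 4) := by
    rw [besselJ, besselClifford, ← tsum_mul_left]
    simp only [besselJ_term]
  rw [h, abs_mul, abs_of_nonneg (by positivity),
    div_eq_mul_one_div _ (n.factorial : ℝ)]
  gcongr
  exact abs_besselClifford_le n (by positivity)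

/-- Pairs of naturals, indexed by their difference and their minimum. -/
def intProdNatEquiv : ℤ × ℕ ≃ ℕ × ℕ where
  toFun p := (p.1.toNat + p.2, (-p.1).toNat + p.2)
  invFun q := ((q.1 : ℤ) - q.2, min q.1 q.2)
  left_inv := by
    rintro ⟨n, k⟩
    simp only [Prod.mk.injEq]
    omega
  right_inv := by
    rintro ⟨a, b⟩
    simp only [Prod.mk.injEq]
    omega

lemma exp_series_term_mul (M : ℝ) {u v : ℂ} (huv : u * v = 1) (m k : ℕ) :
    (Complex.I * (M / 2) * u) ^ (m + k) / (m + k).factorial *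
        ((Complex.I * (M / 2) * v) ^ k / k.factorial) =
      Complex.I ^ m * u ^ m *
        ((-1 : ℝ) ^ k * (M / 2) ^ (m + 2 * k) / (k.factorial * (m + k).factorial) : ℝ) := by
  have h : (Complex.I * (M / 2) * u) ^ (m + k) * (Complex.I * (M / 2) * v) ^ k =
      Complex.I ^ m * u ^ m * ((-1) ^ k * (M / 2) ^ (m + 2 * k)) := by
    calc _ = Complex.I ^ m * u ^ m * ((M / 2 : ℂ) ^ (m + 2 * k)) *
          ((Complex.I * Complex.I) ^ k * (u * v) ^ k) := by ring
      _ = _ := by rw [huv, Complex.I_mul_I]; ring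
  rw [div_mul_div_comm, h]
  push_cast
  ring

lemma hasSum_prod_mul {f g : ℕ → ℂ} {a b : ℂ} (hf : HasSum f a) (hg : HasSum g b) :
    HasSum (fun p : ℕ × ℕ => f p.1 * g p.2) (a * b) :=
  hf.mul hg (summable_mul_of_summable_norm hf.summable.norm hg.summable.norm)

lemma hasSum_exp_series (z : ℂ) :
    HasSum (fun a : ℕ => z ^ a / (a.factorial : ℂ)) (Complex.exp z) := by
  rw [Complex.exp_eq_exp_ℂ]
  exact NormedSpace.expSeries_div_hasSum_exp z

/-- The Jacobi–Anger expansion, as a sum over `ℤ`. -/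
lemma hasSum_jacobiAnger_int (M θ : ℝ) :
    HasSum (fun n : ℤ => Complex.I ^ n.natAbs * Complex.exp (n * (θ * Complex.I)) *
      besselJ n.natAbs M) (Complex.exp (Complex.I * (M * Real.cos θ : ℝ))) := by
  set u := Complex.exp (θ * Complex.I) with hu
  set v := Complex.exp (-(θ * Complex.I)) with hv
  have huv : u * v = 1 := by rw [hu, hv, ← Complex.exp_add, add_neg_cancel, Complex.exp_zero]
  have hprod := hasSum_prod_mul (hasSum_exp_series (Complex.I * (M / 2) * u))
    (hasSum_exp_series (Complex.I * (M / 2) * v))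
  rw [← Complex.exp_add, ← mul_add] at hprod
  have hcos : Complex.I * (M / 2) * (u + v) = Complex.I * (M * Real.cos θ : ℝ) := by
    push_cast
    rw [Complex.cos, hu, hv, neg_mul]
    ring
  rw [hcos] at hprod
  have hequiv := intProdNatEquiv.hasSum_iff.2 hprod
  refine hequiv.prod_fiberwise fun n => ?_
  obtain ⟨m, rfl | rfl⟩ := n.eq_nat_or_neg
  · have := ((Complex.hasSum_ofReal.2 (hasSum_besselJ m M)).mul_left (Complex.I ^ m * u ^ m))
    simp only [← exp_series_term_mul M huv] at this
    simpa [intProdNatEquiv, hu, ← Complex.exp_nat_mul] using this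
  · have := ((Complex.hasSum_ofReal.2 (hasSum_besselJ m M)).mul_left (Complex.I ^ m * v ^ m))
    simp only [← exp_series_term_mul M ((mul_comm v u).trans huv)] at this
    simpa [intProdNatEquiv, hv, ← Complex.exp_nat_mul, mul_comm] using this

/-- The Jacobi–Anger expansion. -/
lemma hasSum_jacobiAnger (M θ : ℝ) :
    HasSum (fun n : ℕ => Complex.I ^ n * (2 * Real.cos (n * θ) * besselJ n M : ℝ))
      (Complex.exp (Complex.I * (M * Real.cos θ : ℝ)) + besselJ 0 M) := by
  have h := (hasSum_jacobiAnger_int M θ).nat_add_neg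
  simp only [Int.natAbs_zero, pow_zero, Int.cast_zero, zero_mul, Complex.exp_zero, one_mul] at h
  convert h using 2 with n
  simp only [Int.natAbs_neg, Int.natAbs_natCast, Int.cast_neg, Int.cast_natCast]
  push_cast
  rw [Complex.cos, show -((n : ℂ) * θ) * Complex.I = -n * (θ * Complex.I) by ring, mul_assoc]
  ring_nf

lemma hasSum_cos_jacobiAnger (M θ : ℝ) :
    HasSum (fun k : ℕ => 2 * ((-1 : ℝ) ^ k * besselJ (2 * k) M * Real.cos ((2 * k : ℕ) * θ)))
      (Real.cos (M * Real.cos θ) + besselJ 0 M) := by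
  have h := Complex.hasSum_re (hasSum_jacobiAnger M θ)
  rw [Complex.add_re, mul_comm Complex.I, Complex.exp_ofReal_mul_I_re, Complex.ofReal_re] at h
  simp only [Complex.re_mul_ofReal] at h
  rw [← Function.Injective.hasSum_iff (g := fun k : ℕ => 2 * k)
    (mul_right_injective₀ two_ne_zero)] at h
  · convert h using 2 with k
    have : Complex.I ^ (2 * k) = ((-1 : ℝ) ^ k : ℝ) := by
      rw [pow_mul, Complex.I_sq]; push_cast; rfl
    simp only [Function.comp_apply, this, Complex.ofReal_re]
    ring
  · intro n hn
    obtain ⟨k, rfl | rfl⟩ := n.even_or_odd'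
    · exact absurd ⟨k, rfl⟩ hn
    · have : Complex.I ^ (2 * k + 1) = ((-1 : ℝ) ^ k : ℝ) * Complex.I := by
        rw [pow_succ, pow_mul, Complex.I_sq]; push_cast; rfl
      rw [this, Complex.re_ofReal_mul, Complex.I_re, mul_zero, zero_mul]

lemma hasSum_sin_jacobiAnger (M θ : ℝ) :
    HasSum (fun k : ℕ =>
        2 * ((-1 : ℝ) ^ k * besselJ (2 * k + 1) M * Real.cos ((2 * k + 1 : ℕ) * θ)))
      (Real.sin (M * Real.cos θ)) := by
  have h := Complex.hasSum_im (hasSum_jacobiAnger M θ)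
  rw [Complex.add_im, mul_comm Complex.I, Complex.exp_ofReal_mul_I_im, Complex.ofReal_im,
    add_zero] at h
  simp only [Complex.im_mul_ofReal] at h
  rw [← Function.Injective.hasSum_iff (g := fun k : ℕ => 2 * k + 1)
    (fun a b hab => by simpa using hab)] at h
  · convert h using 2 with k
    have : Complex.I ^ (2 * k + 1) = ((-1 : ℝ) ^ k : ℝ) * Complex.I := by
      rw [pow_succ, pow_mul, Complex.I_sq]; push_cast; rfl
    simp only [Function.comp_apply, this, Complex.im_ofReal_mul, Complex.I_im]
    ring
  · intro n hn
    obtain ⟨k, rfl | rfl⟩ := n.even_or_odd'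
    · have : Complex.I ^ (2 * k) = ((-1 : ℝ) ^ k : ℝ) := by
        rw [pow_mul, Complex.I_sq]; push_cast; rfl
      rw [this, Complex.ofReal_im, zero_mul]
    · exact absurd ⟨k, rfl⟩ hn

lemma pow_div_factorial_add_two_mul_le {c : ℝ} {q : ℕ} (hc : 0 ≤ c) (hcq : 2 * c ≤ q) (k : ℕ) :
    c ^ (q + 2 * k) / (q + 2 * k).factorial ≤ c ^ q / q.factorial * (1 / 4) ^ k := by
  induction k with
  | zero => simp
  | succ k ih =>
    have hf : (0 : ℝ) < (q + 2 * k).factorial := by exact_mod_cast Nat.factorial_pos _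
    have hfac : ((q + 2 * (k + 1)).factorial : ℝ) =
        ((q + 2 * k + 2) * (q + 2 * k + 1)) * (q + 2 * k).factorial := by
      rw [show q + 2 * (k + 1) = q + 2 * k + 1 + 1 by ring, Nat.factorial_succ, Nat.factorial_succ]
      push_cast
      ring
    have hratio : c ^ 2 / ((q + 2 * k + 2) * (q + 2 * k + 1)) ≤ 1 / 4 := by
      rw [div_le_iff₀ (by positivity)]
      have hk : (0 : ℝ) ≤ k := k.cast_nonneg
      nlinarith
    calc c ^ (q + 2 * (k + 1)) / (q + 2 * (k + 1)).factorial
        = c ^ (q + 2 * k) / (q + 2 * k).factorial *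
            (c ^ 2 / ((q + 2 * k + 2) * (q + 2 * k + 1))) := by
          rw [hfac, div_mul_div_comm, ← pow_add, mul_comm ((q + 2 * k).factorial : ℝ)]
          ring
      _ ≤ c ^ q / q.factorial * (1 / 4) ^ k * (1 / 4) := by gcongr
      _ = _ := by ring

/-- The leading term of the tail is controlled by `(t/r)^r`, through Stirling's lower bound. -/
lemma pow_div_factorial_le_of_lt {M r : ℝ} {q : ℕ} (hM : 0 < M) (hr : Real.exp 1 * M / 2 < r)
    (hrq : r ≤ q) (hq : 2 ≤ q) :
    (M / 2) ^ q / q.factorial ≤ 3 / 10 * (Real.exp 1 * M / 2 / r) ^ r := by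
  have ht : 0 < Real.exp 1 * M / 2 := by positivity
  have hr0 : 0 < r := ht.trans hr
  have hq0 : (0 : ℝ) < q := hr0.trans_le hrq
  have hq2 : (2 : ℝ) ≤ q := by exact_mod_cast hq
  have hsqrt : 10 / 3 ≤ √(2 * π * q) := by
    apply Real.le_sqrt_of_sq_le
    nlinarith [Real.pi_gt_three]
  have hpow : (Real.exp 1 * M / 2 / q) ^ q ≤ (Real.exp 1 * M / 2 / r) ^ r := by
    calc (Real.exp 1 * M / 2 / q) ^ q ≤ (Real.exp 1 * M / 2 / r) ^ q := by gcongr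
      _ = (Real.exp 1 * M / 2 / r) ^ (q : ℝ) := (Real.rpow_natCast _ _).symm
      _ ≤ _ := Real.rpow_le_rpow_of_exponent_ge (by positivity) ((div_le_one hr0).2 hr.le) hrq
  have hstir : 10 / 3 * (q / Real.exp 1) ^ q ≤ q.factorial :=
    le_trans (by gcongr) (Stirling.le_factorial_stirling q)
  calc (M / 2) ^ q / q.factorial ≤ (M / 2) ^ q / (10 / 3 * (q / Real.exp 1) ^ q) := by gcongr
    _ = 3 / 10 * (Real.exp 1 * M / 2 / q) ^ q := by
      simp only [div_pow, mul_pow]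
      field_simp
    _ ≤ _ := by gcongr

lemma abs_sum_range_sub_le_of_abs_le_besselJ {M ε r : ℝ} (hM : 0 < M)
    (hr : Real.exp 1 * M / 2 < r) (hreq : (Real.exp 1 * M / 2 / r) ^ r = 5 * ε / 4)
    {f : ℕ → ℝ} {S : ℝ} (hf : HasSum f S) {N q : ℕ} (hrq : r ≤ q) (hq : 2 ≤ q)
    (hfJ : ∀ k, |f (k + N)| ≤ 2 * |besselJ (q + 2 * k) M|) :
    |∑ k ∈ Finset.range N, f k - S| ≤ ε := by
  have hMq : 2 * (M / 2) ≤ q := by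
    have := Real.add_one_le_exp (1 : ℝ)
    nlinarith
  have hlead := pow_div_factorial_le_of_lt hM hr hrq hq
  have hgeom : HasSum (fun k : ℕ => 2 * ((M / 2) ^ q / q.factorial * (1 / 4 : ℝ) ^ k))
      (2 * ((M / 2) ^ q / q.factorial * (1 - 1 / 4)⁻¹)) :=
    ((hasSum_geometric_of_lt_one (by norm_num) (by norm_num)).mul_left _).mul_left _
  rw [abs_sub_comm, ← Real.norm_eq_abs]
  refine (((hasSum_nat_add_iff' N).2 hf).norm_le_of_bounded hgeom fun k => ?_).trans ?_
  · refine (hfJ k).trans ?_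
    gcongr
    exact (abs_besselJ_le _ hM.le).trans
      (pow_div_factorial_add_two_mul_le (by positivity) hMq k)
  · rw [hreq] at hlead
    linarith

lemma abs_two_mul_neg_one_pow_mul_cos_le (k : ℕ) (a t : ℝ) :
    |2 * ((-1 : ℝ) ^ k * a * Real.cos t)| ≤ 2 * |a| := by
  rw [abs_mul, abs_mul, abs_mul, abs_pow, abs_neg, abs_one, one_pow, one_mul, abs_two]
  nlinarith [Real.abs_cos_le_one t, abs_nonneg a]

lemma jaCos_cos (R : ℕ) (M θ : ℝ) :
    jaCos R M (Real.cos θ) = ∑ k ∈ Finset.range (R + 1),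
      2 * ((-1 : ℝ) ^ k * besselJ (2 * k) M * Real.cos ((2 * k : ℕ) * θ)) - besselJ 0 M := by
  rw [Finset.sum_range_succ', jaCos, Finset.mul_sum, Finset.range_eq_Ico,
    ← Finset.Ico_add_one_right_eq_Icc, Finset.sum_Ico_eq_sum_range]
  simp only [Polynomial.Chebyshev.T_real_cos, add_comm 1, Nat.add_sub_cancel,
    ← Finset.range_eq_Ico]
  push_cast
  simp
  ring

lemma jaSin_cos (R : ℕ) (M θ : ℝ) :
    jaSin R M (Real.cos θ) = ∑ k ∈ Finset.range (R + 1),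
      2 * ((-1 : ℝ) ^ k * besselJ (2 * k + 1) M * Real.cos ((2 * k + 1 : ℕ) * θ)) := by
  simp only [jaSin, Finset.mul_sum, Polynomial.Chebyshev.T_real_cos]
  push_cast
  rfl


/-- Truncation bound for the Jacobi–Anger expansions: with
`R = ⌊r(eM/2, 5ε/4)/2⌋`, where `r(t,ε')` is the unique `r > t` with `(t/r)^r = ε'`,
one has `|C_R(x;M) − cos(Mx)| ≤ ε` and `|S_R(x;M) − sin(Mx)| ≤ ε` on `[−1,1]`. -/
theorem jacobi_anger_truncation (M ε : ℝ) (hM : 0 < M) (hε : ε ∈ Set.Ioo (0 : ℝ) 1)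
    (r : ℝ) (hr : Real.exp 1 * M / 2 < r)
    (hreq : (Real.exp 1 * M / 2 / r) ^ r = 5 * ε / 4)
    (R : ℕ) (hR : R = ⌊r / 2⌋₊) :
    ∀ x ∈ Set.Icc (-1 : ℝ) 1,
      |jaCos R M x - Real.cos (M * x)| ≤ ε ∧ |jaSin R M x - Real.sin (M * x)| ≤ ε := by
  intro x hx
  obtain ⟨θ, rfl⟩ : ∃ θ, Real.cos θ = x := ⟨Real.arccos x, Real.cos_arccos hx.1 hx.2⟩
  have hfloor : r < 2 * R + 2 := by
    have := Nat.lt_floor_add_one (r / 2)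
    rw [← hR] at this
    linarith
  constructor
  · have h := abs_sum_range_sub_le_of_abs_le_besselJ hM hr hreq (hasSum_cos_jacobiAnger M θ)
      (N := R + 1) (q := 2 * R + 2) (by push_cast; linarith) (by omega) fun k => by
        rw [show 2 * R + 2 + 2 * k = 2 * (k + (R + 1)) by ring]
        exact abs_two_mul_neg_one_pow_mul_cos_le _ _ _
    rwa [jaCos_cos, sub_sub, add_comm (besselJ 0 M)]
  · rw [jaSin_cos]
    exact abs_sum_range_sub_le_of_abs_le_besselJ hM hr hreq (hasSum_sin_jacobiAnger M θ)
      (N := R + 1) (q := 2 * R + 3) (by push_cast; linarith) (by omega) fun k => by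
        rw [show 2 * R + 3 + 2 * k = 2 * (k + (R + 1)) + 1 by ring]
        exact abs_two_mul_neg_one_pow_mul_cos_le _ _ _
end

section
/- For every M > 0 and every x ∈ [−1,1] one has the absolutely convergent Chebyshev expansion e^{−Mx²} = e^{−M/2} I_0(M/2) + 2 e^{−M/2} Σ_{n=1}^∞ (−1)^n I_n(M/2) T_{2n}(x), where I_n(y) = Σ_{k=0}^∞ (y/2)^{n+2k} / (k!(n+k)!) is the modified Bessel function of the first kind (so that (−1)^n I_n(M/2) = i^n J_n(iM/2)) and T_n is the n-th Chebyshev polynomial of the first kind. -/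
open Real Polynomial

/-- The modified Bessel function of the first kind
`I_n(y) = Σ_k (y/2)^{n+2k}/(k!(n+k)!)`. -/
noncomputable def besselI (n : ℕ) (y : ℝ) : ℝ :=
  ∑' k : ℕ, (y / 2) ^ (n + 2 * k) / (k.factorial * (n + k).factorial)

/-- Pairs of natural numbers, indexed by their difference and their minimum. -/
def natProdEquivIntProd : ℕ × ℕ ≃ ℤ × ℕ where
  toFun p := ((p.1 : ℤ) - p.2, min p.1 p.2)
  invFun r := (r.2 + r.1.toNat, r.2 + (-r.1).toNat)
  left_inv p := by ext <;> dsimp only <;> omega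
  right_inv r := by ext <;> dsimp only <;> omega

/-- The double series of `exp (z + w)`, obtained by multiplying two exponential series. -/
theorem hasSum_prod_exp_add (z w : ℂ) :
    HasSum (fun p : ℕ × ℕ => z ^ p.1 / (p.1.factorial : ℂ) * (w ^ p.2 / (p.2.factorial : ℂ)))
      (Complex.exp (z + w)) := by
  have hs (z : ℂ) : Summable fun n : ℕ => ‖z ^ n / (n.factorial : ℂ)‖ :=
    NormedSpace.norm_expSeries_div_summable z
  have he (z : ℂ) : HasSum (fun n : ℕ => z ^ n / (n.factorial : ℂ)) (Complex.exp z) := by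
    rw [Complex.exp_eq_exp_ℂ]
    exact NormedSpace.expSeries_div_hasSum_exp z
  rw [Complex.exp_add]
  have h := summable_mul_of_summable_norm (hs z) (hs w)
  exact HasSum.mul (f := fun n : ℕ => z ^ n / (n.factorial : ℂ))
    (g := fun n : ℕ => w ^ n / (n.factorial : ℂ)) (he z) (he w) h

/-- The double series of `exp (y * cos φ)`. -/
theorem hasSum_prod_exp_mul_cos (y φ : ℝ) :
    HasSum (fun p : ℕ × ℕ => (y / 2) ^ (p.1 + p.2) / (p.1.factorial * p.2.factorial) *
      Real.cos (((p.1 : ℤ) - p.2 : ℤ) * φ)) (Real.exp (y * Real.cos φ)) := by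
  have h := hasSum_prod_exp_add ((y / 2 : ℂ) * Complex.exp (φ * Complex.I))
    ((y / 2 : ℂ) * Complex.exp (-φ * Complex.I))
  rw [← mul_add] at h
  have hsum : (y / 2 : ℂ) * (Complex.exp (φ * Complex.I) + Complex.exp (-φ * Complex.I)) =
      ((y * Real.cos φ : ℝ) : ℂ) := by
    rw [← Complex.two_cos]
    push_cast
    ring
  rw [hsum] at h
  have hterm (p : ℕ × ℕ) : ((y / 2 : ℂ) * Complex.exp (φ * Complex.I)) ^ p.1 / (p.1.factorial : ℂ) *
      (((y / 2 : ℂ) * Complex.exp (-φ * Complex.I)) ^ p.2 / (p.2.factorial : ℂ)) =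
      (((y / 2) ^ (p.1 + p.2) / (p.1.factorial * p.2.factorial) : ℝ) : ℂ) *
        Complex.exp (((((p.1 : ℤ) - p.2 : ℤ) * φ : ℝ) : ℂ) * Complex.I) := by
    have hexp : Complex.exp (((((p.1 : ℤ) - p.2 : ℤ) * φ : ℝ) : ℂ) * Complex.I) =
        Complex.exp (φ * Complex.I) ^ p.1 * Complex.exp (-φ * Complex.I) ^ p.2 := by
      rw [← Complex.exp_nat_mul, ← Complex.exp_nat_mul, ← Complex.exp_add]
      congr 1
      push_cast
      ring
    rw [hexp, mul_pow, mul_pow]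
    push_cast
    ring
  simp only [hterm] at h
  simpa only [Complex.re_ofReal_mul, Complex.exp_ofReal_mul_I_re, Complex.exp_ofReal_re] using
    Complex.hasSum_re h

/-- The Jacobi–Anger expansion of `exp (y * cos φ)`, as a series over the integers. -/
theorem hasSum_besselI_natAbs_mul_cos (y φ : ℝ) :
    HasSum (fun n : ℤ => besselI n.natAbs y * Real.cos (n * φ)) (Real.exp (y * Real.cos φ)) := by
  have h := natProdEquivIntProd.symm.hasSum_iff.mpr (hasSum_prod_exp_mul_cos y φ)
  convert h.prod_fiberwise fun n => (h.summable.prod_factor n).hasSum using 2 with n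
  rw [besselI, ← tsum_mul_right]
  refine tsum_congr fun k => ?_
  have hdiff : ((k + n.toNat : ℕ) : ℤ) - (k + (-n).toNat : ℕ) = n := by omega
  simp only [Function.comp_apply, natProdEquivIntProd, Equiv.coe_fn_symm_mk, hdiff]
  congr 1
  obtain hn | hn := le_total 0 n
  · rw [show n.toNat = n.natAbs by omega, show (-n).toNat = 0 by omega, add_zero,
      show k + n.natAbs + k = n.natAbs + 2 * k by ring, add_comm k, mul_comm (k.factorial : ℝ)]
  · rw [show (-n).toNat = n.natAbs by omega, show n.toNat = 0 by omega, add_zero,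
      show k + (k + n.natAbs) = n.natAbs + 2 * k by ring, add_comm k]

/-- The Jacobi–Anger expansion of `exp (y * cos φ)`, as a cosine series. -/
theorem hasSum_two_mul_besselI_mul_cos (y φ : ℝ) :
    HasSum (fun n : ℕ => 2 * besselI (n + 1) y * Real.cos ((n + 1) * φ))
      (Real.exp (y * Real.cos φ) - besselI 0 y) := by
  have h := (hasSum_nat_add_iff' 1).mpr (hasSum_besselI_natAbs_mul_cos y φ).nat_add_neg
  have hterm (n : ℕ) : besselI ((n + 1 : ℕ) : ℤ).natAbs y * Real.cos (((n + 1 : ℕ) : ℤ) * φ) +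
      besselI (-((n + 1 : ℕ) : ℤ)).natAbs y * Real.cos ((-((n + 1 : ℕ) : ℤ) : ℤ) * φ) =
      2 * besselI (n + 1) y * Real.cos ((n + 1) * φ) := by
    rw [Int.natAbs_neg, Int.natAbs_natCast]
    push_cast
    rw [neg_mul, Real.cos_neg]
    ring
  simp only [hterm] at h
  convert! h using 1
  simp

/-- The absolutely convergent Chebyshev expansion
`e^{−Mx²} = e^{−M/2} I_0(M/2) + 2 e^{−M/2} Σ_{n=1}^∞ (−1)^n I_n(M/2) T_{2n}(x)`
for `M > 0` and `x ∈ [−1,1]`. -/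
theorem gaussian_chebyshev_expansion (M : ℝ) (hM : 0 < M) (x : ℝ)
    (hx : x ∈ Set.Icc (-1 : ℝ) 1) :
    Summable (fun n : ℕ =>
      |2 * Real.exp (-M / 2) * (-1 : ℝ) ^ (n + 1) * besselI (n + 1) (M / 2) *
        (Chebyshev.T ℝ (2 * (n + 1) : ℤ)).eval x|) ∧
    Real.exp (-M * x ^ 2) =
      Real.exp (-M / 2) * besselI 0 (M / 2) +
        ∑' n : ℕ, 2 * Real.exp (-M / 2) * (-1 : ℝ) ^ (n + 1) * besselI (n + 1) (M / 2) *
          (Chebyshev.T ℝ (2 * (n + 1) : ℤ)).eval x := by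
  obtain ⟨θ, rfl⟩ : ∃ θ, Real.cos θ = x := ⟨Real.arccos x, Real.cos_arccos hx.1 hx.2⟩
  have h := (hasSum_two_mul_besselI_mul_cos (M / 2) (2 * θ + π)).mul_left (Real.exp (-M / 2))
  have hexp : Real.exp (-M / 2) * Real.exp (M / 2 * Real.cos (2 * θ + π)) =
      Real.exp (-M * Real.cos θ ^ 2) := by
    rw [← Real.exp_add, Real.cos_add_pi, Real.cos_two_mul]
    congr 1
    ring
  have hterm (n : ℕ) : Real.exp (-M / 2) *
        (2 * besselI (n + 1) (M / 2) * Real.cos ((n + 1) * (2 * θ + π))) =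
      2 * Real.exp (-M / 2) * (-1 : ℝ) ^ (n + 1) * besselI (n + 1) (M / 2) *
        (Chebyshev.T ℝ (2 * (n + 1) : ℤ)).eval (Real.cos θ) := by
    have hcos := Real.cos_add_nat_mul_pi (2 * (n + 1) * θ) (n + 1)
    rw [Chebyshev.T_real_cos, show ((n : ℝ) + 1) * (2 * θ + π) =
      2 * (n + 1) * θ + (n + 1 : ℕ) * π by push_cast; ring, hcos]
    push_cast
    ring
  simp only [hterm, mul_sub, hexp] at h
  exact ⟨h.summable.abs, by rw [h.tsum_eq]; ring⟩
end

section
/- Let M > 0 and ε ∈ (0,1), and set R = ⌊r(eM/4, 5ε/6)⌋, where r(t, ε') denotes the unique real number r > t satisfying (t/r)^r = ε'. Let E_R(x; M) = e^{−M/2} I_0(M/2) + 2 e^{−M/2} Σ_{n=1}^R (−1)^n I_n(M/2) T_{2n}(x) be the degree-2R truncation of the Chebyshev expansion of e^{−Mx²}. Then |e^{−Mx²} − E_R(x; M)| ≤ ε for all x ∈ [−1,1]. -/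
open Real Polynomial

/-- The degree-`2R` truncation of the Chebyshev expansion of `e^{−Mx²}`:
`E_R(x; M) = e^{−M/2} I_0(M/2) + 2 e^{−M/2} Σ_{n=1}^R (−1)^n I_n(M/2) T_{2n}(x)`. -/
noncomputable def gaussTrunc (R : ℕ) (M x : ℝ) : ℝ :=
  Real.exp (-M / 2) * besselI 0 (M / 2) +
    2 * Real.exp (-M / 2) * ∑ n ∈ Finset.Icc 1 R,
      (-1 : ℝ) ^ n * besselI n (M / 2) * (Chebyshev.T ℝ (2 * n : ℤ)).eval x

/-- The terms of the Bessel series are dominated by those of `(y/2)^n / n! * cosh y`. -/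
theorem besselI_term_le (n k : ℕ) {y : ℝ} (hy : 0 ≤ y) :
    (y / 2) ^ (n + 2 * k) / (k.factorial * (n + k).factorial) ≤
      (y / 2) ^ n / n.factorial * (y ^ (2 * k) / (2 * k).factorial) := by
  have h1 : (2 * k).factorial ≤ 2 ^ (2 * k) * (k.factorial * k.factorial) := by
    have h := Nat.choose_mul_factorial_mul_factorial (show k ≤ 2 * k by omega)
    rw [show 2 * k - k = k by omega] at h
    rw [← h, mul_assoc]
    exact Nat.mul_le_mul_right _ (Nat.choose_le_two_pow _ _)
  have h2 : n.factorial * k.factorial ≤ (n + k).factorial :=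
    Nat.le_of_dvd (Nat.factorial_pos _) (Nat.factorial_mul_factorial_dvd_factorial_add n k)
  have h3 : n.factorial * (2 * k).factorial ≤ 2 ^ (2 * k) * (k.factorial * (n + k).factorial) :=
    calc n.factorial * (2 * k).factorial
        ≤ n.factorial * (2 ^ (2 * k) * (k.factorial * k.factorial)) := Nat.mul_le_mul_left _ h1
      _ = 2 ^ (2 * k) * (k.factorial * (n.factorial * k.factorial)) := by ring
      _ ≤ _ := Nat.mul_le_mul_left _ (Nat.mul_le_mul_left _ h2)
  have h4 : (n.factorial * (2 * k).factorial : ℝ) ≤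
      2 ^ (2 * k) * (k.factorial * (n + k).factorial) := by exact_mod_cast h3
  rw [div_mul_div_comm, pow_add, div_pow y 2 (2 * k), ← mul_div_assoc, div_div]
  gcongr

theorem summable_besselI (n : ℕ) {y : ℝ} (hy : 0 ≤ y) :
    Summable fun k : ℕ => (y / 2) ^ (n + 2 * k) / (k.factorial * (n + k).factorial : ℝ) :=
  Summable.of_nonneg_of_le (fun k => by positivity) (fun k => besselI_term_le n k hy)
    ((Real.hasSum_cosh y).summable.mul_left _)

theorem besselI_nonneg (n : ℕ) {y : ℝ} (hy : 0 ≤ y) : 0 ≤ besselI n y :=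
  tsum_nonneg fun k => by positivity

theorem besselI_le (n : ℕ) {y : ℝ} (hy : 0 ≤ y) :
    besselI n y ≤ (y / 2) ^ n / n.factorial * Real.exp y := by
  have h := hasSum_le (fun k => besselI_term_le n k hy) (summable_besselI n hy).hasSum
    ((Real.hasSum_cosh y).mul_left ((y / 2) ^ n / n.factorial : ℝ))
  refine h.trans (mul_le_mul_of_nonneg_left ?_ (by positivity))
  rw [Real.cosh_eq]
  have : Real.exp (-y) ≤ Real.exp y := Real.exp_le_exp.2 (by linarith)
  linarith

/-- Pairs of naturals are parametrized by their difference and their minimum. -/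
def diffMinEquiv : ℤ × ℕ ≃ ℕ × ℕ where
  toFun p := (p.2 + p.1.toNat, p.2 + (-p.1).toNat)
  invFun q := ((q.1 : ℤ) - q.2, min q.1 q.2)
  left_inv p := by ext <;> simp; omega
  right_inv q := by ext <;> simp <;> omega

theorem hasSum_mul_prod {f g : ℕ → ℂ} {s t : ℂ} (hf : HasSum f s) (hg : HasSum g t)
    (hf' : Summable fun n => ‖f n‖) (hg' : Summable fun n => ‖g n‖) :
    HasSum (fun q : ℕ × ℕ => f q.1 * g q.2) (s * t) :=
  hf.mul hg (summable_mul_of_summable_norm hf' hg')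

theorem hasSum_exp_neg_mul_cos_prod (y φ : ℝ) :
    HasSum (fun q : ℕ × ℕ => (-(y / 2)) ^ (q.1 + q.2) / (q.1.factorial * q.2.factorial) *
      Real.cos (((q.1 : ℝ) - q.2) * φ)) (Real.exp (-y * Real.cos φ)) := by
  have hs (z : ℂ) : HasSum (fun n : ℕ => z ^ n / (n.factorial : ℂ)) (Complex.exp z) := by
    rw [Complex.exp_eq_exp_ℂ]
    exact NormedSpace.expSeries_div_hasSum_exp z
  have hn (z : ℂ) : Summable fun n : ℕ => ‖z ^ n / (n.factorial : ℂ)‖ :=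
    NormedSpace.norm_expSeries_div_summable z
  obtain ⟨a, ha⟩ : ∃ a : ℂ, a = -(y / 2) * Complex.exp (φ * Complex.I) := ⟨_, rfl⟩
  obtain ⟨b, hb⟩ : ∃ b : ℂ, b = -(y / 2) * Complex.exp (-φ * Complex.I) := ⟨_, rfl⟩
  have h := Complex.hasSum_re (hasSum_mul_prod (f := fun n : ℕ => a ^ n / (n.factorial : ℂ))
    (g := fun n : ℕ => b ^ n / (n.factorial : ℂ)) (hs a) (hs b) (hn a) (hn b))
  have hab : Complex.exp a * Complex.exp b = ((Real.exp (-y * Real.cos φ) : ℝ) : ℂ) := by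
    rw [← Complex.exp_add, Complex.ofReal_exp, ha, hb]
    push_cast
    rw [Complex.cos]
    ring_nf
  rw [hab, Complex.ofReal_re] at h
  refine h.congr_fun fun q => Eq.symm ?_
  obtain ⟨m, n⟩ := q
  have e : a ^ m / (m.factorial : ℂ) * (b ^ n / (n.factorial : ℂ)) =
      (((-(y / 2)) ^ (m + n) / (m.factorial * n.factorial) : ℝ) : ℂ) *
        Complex.exp ((((m : ℝ) - n) * φ : ℝ) * Complex.I) := by
    have e1 : Complex.exp ((((m : ℝ) - n) * φ : ℝ) * Complex.I) =
        Complex.exp (φ * Complex.I) ^ m * Complex.exp (-φ * Complex.I) ^ n := by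
      rw [← Complex.exp_nat_mul, ← Complex.exp_nat_mul, ← Complex.exp_add]
      push_cast
      ring_nf
    rw [e1, ha, hb, mul_pow, mul_pow]
    push_cast
    rw [pow_add]
    ring
  rw [e, Complex.re_ofReal_mul, Complex.exp_ofReal_mul_I_re]

theorem hasSum_exp_neg_mul_cos_int {y : ℝ} (hy : 0 ≤ y) (φ : ℝ) :
    HasSum (fun d : ℤ => (-1) ^ d.natAbs * besselI d.natAbs y * Real.cos (d * φ))
      (Real.exp (-y * Real.cos φ)) := by
  have h := (diffMinEquiv.hasSum_iff).2 (hasSum_exp_neg_mul_cos_prod y φ)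
  refine h.prod_fiberwise fun d => ?_
  have h2 := ((summable_besselI d.natAbs hy).hasSum.mul_left ((-1) ^ d.natAbs)).mul_right
    (Real.cos (d * φ))
  refine h2.congr_fun fun k => ?_
  have e1 : k + d.toNat + (k + (-d).toNat) = d.natAbs + 2 * k := by omega
  have e2 : (((k + d.toNat : ℕ) : ℝ) - (k + (-d).toNat : ℕ)) = d := by
    have : (((k + d.toNat : ℕ) : ℤ) - (k + (-d).toNat : ℕ)) = d := by omega
    exact_mod_cast this
  have e3 : ((k + d.toNat).factorial * (k + (-d).toNat).factorial : ℝ) =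
      k.factorial * (d.natAbs + k).factorial := by
    rcases le_total 0 d with hd | hd
    · rw [show (-d).toNat = 0 by omega, show k + d.toNat = d.natAbs + k by omega, add_zero,
        mul_comm]
    · rw [show d.toNat = 0 by omega, show k + (-d).toNat = d.natAbs + k by omega, add_zero]
  simp only [Function.comp_apply, diffMinEquiv, Equiv.coe_fn_mk]
  rw [e1, e2, e3, neg_pow, pow_add (-1 : ℝ), pow_mul, neg_one_sq, one_pow, mul_one, mul_div_assoc]

/-- The Chebyshev (Jacobi–Anger) expansion of `e^{-y cos φ}`. -/
theorem hasSum_exp_neg_mul_cos {y : ℝ} (hy : 0 ≤ y) (φ : ℝ) :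
    HasSum (fun n : ℕ => 2 * ((-1) ^ n * besselI n y * Real.cos (n * φ)))
      (Real.exp (-y * Real.cos φ) + besselI 0 y) := by
  have h := (hasSum_exp_neg_mul_cos_int hy φ).nat_add_neg
  simpa [two_mul] using h

theorem exp_one_mul_pow_le_factorial {n : ℕ} (hn : n ≠ 0) :
    Real.exp 1 * (n / Real.exp 1) ^ n ≤ n.factorial := by
  obtain rfl | h2 : n = 1 ∨ 2 ≤ n := by omega
  · simp
  · refine le_trans ?_ (Stirling.le_factorial_stirling n)
    gcongr
    refine Real.le_sqrt_of_sq_le ?_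
    have h3 : (2 : ℝ) ≤ n := by exact_mod_cast h2
    nlinarith [Real.pi_gt_three, Real.exp_one_lt_d9, Real.exp_pos 1]

/-- `s ↦ (t/s)^s` decays at least like `e^{-s}` beyond `t`. -/
theorem div_rpow_le {t r s : ℝ} (ht : 0 < t) (htr : t ≤ r) (hrs : r ≤ s) :
    (t / s) ^ s ≤ (t / r) ^ r * Real.exp (r - s) := by
  have hr : 0 < r := ht.trans_le htr
  have hs : 0 < s := hr.trans_le hrs
  rw [Real.rpow_def_of_pos (div_pos ht hs), Real.rpow_def_of_pos (div_pos ht hr), ← Real.exp_add,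
    Real.exp_le_exp, Real.log_div ht.ne' hs.ne', Real.log_div ht.ne' hr.ne']
  have h1 : Real.log t ≤ Real.log r := Real.log_le_log ht htr
  have h2 : s * (Real.log r - Real.log s) ≤ r - s := by
    rw [← Real.log_div hr.ne' hs.ne']
    calc s * Real.log (r / s) ≤ s * (r / s - 1) :=
          mul_le_mul_of_nonneg_left (Real.log_le_sub_one_of_pos (div_pos hr hs)) hs.le
      _ = r - s := by field_simp
  nlinarith [mul_nonneg (sub_nonneg.2 hrs) (sub_nonneg.2 h1)]

theorem pow_div_factorial_le {M r : ℝ} (hM : 0 < M) (hr : Real.exp 1 * M / 4 < r) {n : ℕ}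
    (hn : r ≤ n) :
    (M / 4) ^ n / n.factorial ≤
      (Real.exp 1)⁻¹ * ((Real.exp 1 * M / 4 / r) ^ r * Real.exp (r - n)) := by
  have ht : 0 < Real.exp 1 * M / 4 := by positivity
  have hn0 : (0 : ℝ) < n := (ht.trans hr).trans_le hn
  have h1 := div_rpow_le ht hr.le hn
  rw [Real.rpow_natCast] at h1
  refine le_trans ?_ (mul_le_mul_of_nonneg_left h1 (by positivity))
  calc (M / 4) ^ n / n.factorial ≤ (M / 4) ^ n / (Real.exp 1 * (n / Real.exp 1) ^ n) := by
        gcongr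
        exact exp_one_mul_pow_le_factorial (by exact_mod_cast hn0.ne')
    _ = (Real.exp 1)⁻¹ * ((M / 4) / (n / Real.exp 1)) ^ n := by
        rw [div_pow (M / 4)]
        field_simp
    _ = _ := by
        congr 2
        field_simp

theorem gaussTrunc_cos (R : ℕ) (M θ : ℝ) :
    gaussTrunc R M (Real.cos θ) = Real.exp (-M / 2) *
      (∑ n ∈ Finset.range (R + 1),
        2 * ((-1) ^ n * besselI n (M / 2) * Real.cos (n * (2 * θ))) - besselI 0 (M / 2)) := by
  rw [gaussTrunc, Finset.range_eq_Ico, Finset.sum_eq_sum_Ico_succ_bot (Nat.succ_pos R),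
    ← Finset.mul_sum]
  have h : ∀ n : ℕ, (Chebyshev.T ℝ (2 * n : ℤ)).eval (Real.cos θ) = Real.cos (n * (2 * θ)) := by
    intro n
    rw [Chebyshev.T_real_cos]
    push_cast
    ring_nf
  simp only [h]
  rw [show Finset.Ico (0 + 1) (R + 1) = Finset.Icc 1 R by rfl]
  simp
  ring

theorem hasSum_gaussian_sub_gaussTrunc (R : ℕ) {M : ℝ} (hM : 0 ≤ M) (θ : ℝ) :
    HasSum (fun k : ℕ => Real.exp (-M / 2) * (2 * ((-1) ^ (k + (R + 1)) *
        besselI (k + (R + 1)) (M / 2) * Real.cos ((k + (R + 1) : ℕ) * (2 * θ)))))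
      (Real.exp (-M * Real.cos θ ^ 2) - gaussTrunc R M (Real.cos θ)) := by
  have h := ((hasSum_nat_add_iff' (R + 1)).2
    (hasSum_exp_neg_mul_cos (y := M / 2) (by positivity) (2 * θ))).mul_left (Real.exp (-M / 2))
  have h1 : Real.exp (-M * Real.cos θ ^ 2) =
      Real.exp (-M / 2) * Real.exp (-(M / 2) * Real.cos (2 * θ)) := by
    rw [← Real.exp_add, Real.cos_two_mul]
    ring_nf
  rw [gaussTrunc_cos, h1, ← mul_sub, sub_sub_eq_add_sub]
  exact h

theorem gaussian_tail_term_le {M r : ℝ} (hM : 0 < M) (hr : Real.exp 1 * M / 4 < r) {n : ℕ}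
    (hn : r ≤ n) (φ : ℝ) :
    ‖Real.exp (-M / 2) * (2 * ((-1) ^ n * besselI n (M / 2) * Real.cos (n * φ)))‖ ≤
      2 * ((Real.exp 1)⁻¹ * ((Real.exp 1 * M / 4 / r) ^ r * Real.exp (r - n))) := by
  have hB := besselI_nonneg n (y := M / 2) (by positivity)
  have h0 := besselI_le n (y := M / 2) (by positivity)
  have h1 := pow_div_factorial_le hM hr hn
  simp only [norm_mul, norm_pow, norm_neg, norm_one, one_pow, one_mul, Real.norm_eq_abs,
    Real.abs_exp, abs_two, abs_of_nonneg hB]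
  calc Real.exp (-M / 2) * (2 * (besselI n (M / 2) * |Real.cos (n * φ)|))
      ≤ Real.exp (-M / 2) * (2 * (((M / 2 / 2) ^ n / n.factorial * Real.exp (M / 2)) * 1)) := by
        gcongr
        exact Real.abs_cos_le_one _
    _ = 2 * ((M / 4) ^ n / n.factorial) * (Real.exp (-M / 2) * Real.exp (M / 2)) := by
        rw [show M / 2 / 2 = M / 4 by ring]
        ring
    _ = 2 * ((M / 4) ^ n / n.factorial) := by
        rw [← Real.exp_add, show -M / 2 + M / 2 = 0 by ring, Real.exp_zero, mul_one]
    _ ≤ _ := by gcongr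

/-- Truncation bound for the Chebyshev expansion of the Gaussian: with
`R = ⌊r(eM/4, 5ε/6)⌋`, where `r(t,ε')` is the unique `r > t` with `(t/r)^r = ε'`,
one has `|e^{−Mx²} − E_R(x;M)| ≤ ε` for all `x ∈ [−1,1]`. -/
theorem gaussian_truncation (M ε : ℝ) (hM : 0 < M) (hε : ε ∈ Set.Ioo (0 : ℝ) 1)
    (r : ℝ) (hr : Real.exp 1 * M / 4 < r)
    (hreq : (Real.exp 1 * M / 4 / r) ^ r = 5 * ε / 6)
    (R : ℕ) (hR : R = ⌊r⌋₊) :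
    ∀ x ∈ Set.Icc (-1 : ℝ) 1, |Real.exp (-M * x ^ 2) - gaussTrunc R M x| ≤ ε := by
  intro x hx
  rw [← Real.cos_arccos hx.1 hx.2]
  have hlt : r < R + 1 := hR ▸ Nat.lt_floor_add_one r
  have hε0 : 0 < ε := hε.1
  have he : (2.7 : ℝ) < Real.exp 1 := by linarith [Real.exp_one_gt_d9]
  have hgeom : HasSum (fun k : ℕ => 2 * ((Real.exp 1)⁻¹ * (5 * ε / 6)) * (Real.exp 1)⁻¹ ^ k)
      (2 * ((Real.exp 1)⁻¹ * (5 * ε / 6)) * (1 - (Real.exp 1)⁻¹)⁻¹) :=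
    (hasSum_geometric_of_lt_one (by positivity)
      (inv_lt_one_of_one_lt₀ (by linarith))).mul_left _
  refine ((hasSum_gaussian_sub_gaussTrunc R hM.le _).norm_le_of_bounded hgeom
    fun k => ?_).trans ?_
  · have hn : r ≤ (k + (R + 1) : ℕ) := by
      push_cast
      linarith [(Nat.cast_nonneg k : (0 : ℝ) ≤ k)]
    refine (gaussian_tail_term_le hM hr hn _).trans ?_
    rw [hreq, ← Real.exp_neg, ← Real.exp_nat_mul, mul_assoc 2, mul_assoc (Real.exp (-1))]
    gcongr
    push_cast
    linarith
  · have h1 : (Real.exp 1)⁻¹ * (1 - (Real.exp 1)⁻¹)⁻¹ = (Real.exp 1 - 1)⁻¹ := by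
      rw [← mul_inv, mul_sub, mul_one, mul_inv_cancel₀ (by positivity)]
    calc 2 * ((Real.exp 1)⁻¹ * (5 * ε / 6)) * (1 - (Real.exp 1)⁻¹)⁻¹
        = 5 * ε / 3 * ((Real.exp 1)⁻¹ * (1 - (Real.exp 1)⁻¹)⁻¹) := by ring
      _ ≤ ε := by
        rw [h1, ← div_eq_mul_inv, div_le_iff₀ (by linarith)]
        nlinarith
end

section
/- Let N be an even positive integer, d > 0, Δx = d/N, ω = 2π/d, and let 𝒯_N = Span_ℂ{e_k(x) = e^{iωkx} : −N/2 ≤ k < N/2}, equipped with the standard L² inner product on [0,d]. Then the evaluation map ev : 𝒯_N → ℂ^N given by ev(q)_j = q(jΔx) for 0 ≤ j < N is a linear isomorphism, and ‖q‖_{L²([0,d])} = (Δx)^{1/2} ‖ev(q)‖ for every q ∈ 𝒯_N, where ℂ^N carries the standard Hermitian norm. -/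
open Real Complex

/-- The squared modulus of a trigonometric sum, expanded as a double sum. -/
lemma norm_sq_sum_exp {ι : Type*} [Fintype ι] (ω : ℝ) (m : ι → ℤ) (c : ι → ℂ) (x : ℝ) :
    ((‖∑ k, c k * Complex.exp (Complex.I * ω * (m k : ℂ) * x)‖ ^ 2 : ℝ) : ℂ) =
      ∑ k, ∑ l, (starRingEnd ℂ (c k) * c l) *
        Complex.exp (Complex.I * ω * ((m l - m k : ℤ) : ℂ) * x) := by
  rw [Complex.ofReal_pow, ← Complex.conj_mul', map_sum, Finset.sum_mul_sum]
  refine Finset.sum_congr rfl fun k _ => Finset.sum_congr rfl fun l _ => ?_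
  rw [map_mul, ← Complex.exp_conj, mul_mul_mul_comm, ← Complex.exp_add]
  congr 2
  simp only [map_mul, Complex.conj_I, Complex.conj_ofReal, map_intCast]
  push_cast
  ring

lemma integral_exp_period {d ω : ℝ} (hd : 0 < d) (hω : ω = 2 * Real.pi / d) (n : ℤ) :
    ∫ x in (0 : ℝ)..d, Complex.exp (Complex.I * ω * (n : ℂ) * x) = if n = 0 then (d : ℂ) else 0 := by
  split_ifs with hn
  · simp [hn]
  · have hω0 : ω ≠ 0 := by rw [hω]; positivity
    have hc : Complex.I * ω * (n : ℂ) ≠ 0 := by simp [hω0, hn]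
    have hd0 : (d : ℂ) ≠ 0 := by exact_mod_cast hd.ne'
    have h : Complex.I * ω * (n : ℂ) * d = n * (2 * Real.pi * Complex.I) := by
      rw [hω]; push_cast; field_simp
    rw [integral_exp_mul_complex hc, h, Complex.exp_int_mul_two_pi_mul_I]
    simp

lemma sum_exp_grid {N : ℕ} (hN : 0 < N) {d ω Δx : ℝ} (hd : 0 < d) (hω : ω = 2 * Real.pi / d)
    (hΔx : Δx = d / N) {n : ℤ} (hn : |n| < N) :
    ∑ j : Fin N, Complex.exp (Complex.I * ω * (n : ℂ) * (((j : ℕ) * Δx : ℝ) : ℂ)) =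
      if n = 0 then (N : ℂ) else 0 := by
  split_ifs with h0
  · simp [h0]
  · have hd0 : (d : ℂ) ≠ 0 := by exact_mod_cast hd.ne'
    have hN0 : (N : ℂ) ≠ 0 := by exact_mod_cast hN.ne'
    have hterm (j : ℕ) : Complex.exp (Complex.I * ω * (n : ℂ) * ((j * Δx : ℝ) : ℂ)) =
        Complex.exp (n / N * (2 * Real.pi * Complex.I)) ^ j := by
      rw [← Complex.exp_nat_mul, hω, hΔx]
      congr 1
      push_cast
      field_simp
    simp only [hterm]
    rw [Fin.sum_univ_eq_sum_range
      (fun j => Complex.exp (n / N * (2 * Real.pi * Complex.I)) ^ j)]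
    have hne : Complex.exp (n / N * (2 * Real.pi * Complex.I)) ≠ 1 := by
      rw [Ne, Complex.exp_eq_one_iff]
      rintro ⟨p, hp⟩
      have h2 := mul_right_cancel₀ Complex.two_pi_I_ne_zero hp
      rw [div_eq_iff hN0] at h2
      have h3 : n = p * N := by exact_mod_cast h2
      exact h0 (Int.eq_zero_of_abs_lt_dvd ⟨p, by rw [h3, mul_comm]⟩ hn)
    have hpow : Complex.exp (n / N * (2 * Real.pi * Complex.I)) ^ N = 1 := by
      rw [← Complex.exp_nat_mul, ← mul_assoc, mul_div_cancel₀ _ hN0,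
        Complex.exp_int_mul_two_pi_mul_I]
    rw [geom_sum_eq hne, hpow, sub_self, zero_div]

lemma sum_sum_conj_mul_ite {ι : Type*} [Fintype ι] {m : ι → ℤ} (hm : Function.Injective m)
    (c : ι → ℂ) (a : ℂ) :
    ∑ k, ∑ l, (starRingEnd ℂ (c k) * c l) * (if m l - m k = 0 then a else 0) =
      ((∑ k, ‖c k‖ ^ 2 : ℝ) : ℂ) * a := by
  classical
  simp only [sub_eq_zero, hm.eq_iff, mul_ite, mul_zero, Finset.sum_ite_eq', Finset.mem_univ,
    if_true, Complex.conj_mul', ← Finset.sum_mul]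
  push_cast
  rfl

/-- Parseval's identity on a period. -/
lemma integral_norm_sq_sum_exp {ι : Type*} [Fintype ι] {d ω : ℝ} (hd : 0 < d)
    (hω : ω = 2 * Real.pi / d) {m : ι → ℤ} (hm : Function.Injective m) (c : ι → ℂ) :
    ∫ x in (0 : ℝ)..d, ‖∑ k, c k * Complex.exp (Complex.I * ω * (m k : ℂ) * x)‖ ^ 2 =
      (∑ k, ‖c k‖ ^ 2) * d := by
  apply Complex.ofReal_injective
  rw [← intervalIntegral.integral_ofReal]
  simp only [norm_sq_sum_exp]
  have hint (k l : ι) : IntervalIntegrable (fun x : ℝ => (starRingEnd ℂ (c k) * c l) *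
      Complex.exp (Complex.I * ω * ((m l - m k : ℤ) : ℂ) * x)) MeasureTheory.volume 0 d :=
    Continuous.intervalIntegrable (by fun_prop) _ _
  rw [intervalIntegral.integral_finsetSum fun k _ =>
    by simpa only [Finset.sum_fn] using IntervalIntegrable.sum _ fun l _ => hint k l]
  simp only [intervalIntegral.integral_finsetSum fun l _ => hint _ l,
    intervalIntegral.integral_const_mul, integral_exp_period hd hω, sum_sum_conj_mul_ite hm,
    Complex.ofReal_mul]

/-- Parseval's identity on the grid. -/
lemma sum_norm_sq_sum_exp {ι : Type*} [Fintype ι] {N : ℕ} (hN : 0 < N) {d ω Δx : ℝ} (hd : 0 < d)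
    (hω : ω = 2 * Real.pi / d) (hΔx : Δx = d / N) {m : ι → ℤ} (hm : Function.Injective m)
    (hmN : ∀ k l, |m l - m k| < N) (c : ι → ℂ) :
    ∑ j : Fin N, ‖∑ k, c k *
      Complex.exp (Complex.I * ω * (m k : ℂ) * (((j : ℕ) * Δx : ℝ) : ℂ))‖ ^ 2 =
      (∑ k, ‖c k‖ ^ 2) * N := by
  apply Complex.ofReal_injective
  rw [Complex.ofReal_sum]
  simp only [norm_sq_sum_exp]
  simp only [Finset.sum_comm (s := (Finset.univ : Finset (Fin N))), ← Finset.mul_sum,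
    sum_exp_grid hN hd hω hΔx (hmN _ _), sum_sum_conj_mul_ite hm]
  rw [Complex.ofReal_mul, Complex.ofReal_natCast]

/-- The evaluation map on the space `𝒯_N` spanned by the Fourier modes
`e_k(x) = e^{iωkx}`, `−N/2 ≤ k < N/2`, is a linear isomorphism onto `ℂ^N`, and
`‖q‖_{L²([0,d])} = (Δx)^{1/2} ‖ev(q)‖` for every `q ∈ 𝒯_N`. -/
theorem evaluation_map_isomorphism (N : ℕ) (hN : Even N) (hNpos : 0 < N)
    (d : ℝ) (hd : 0 < d) (ω Δx : ℝ) (hω : ω = 2 * Real.pi / d) (hΔx : Δx = d / N)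
    (TN : Submodule ℂ (ℝ → ℂ))
    (hTN : TN = Submodule.span ℂ (Set.range fun k : Fin N =>
      fun x : ℝ => Complex.exp (Complex.I * ω * (((k : ℤ) - (N : ℤ) / 2 : ℤ) : ℂ) * x))) :
    (∃ e : TN ≃ₗ[ℂ] (Fin N → ℂ),
      ∀ q : TN, e q = fun j : Fin N => (q : ℝ → ℂ) ((j : ℕ) * Δx)) ∧
    ∀ q ∈ TN,
      Real.sqrt (∫ x in (0 : ℝ)..d, ‖q x‖ ^ 2) =
        Real.sqrt Δx * Real.sqrt (∑ j : Fin N, ‖q ((j : ℕ) * Δx)‖ ^ 2) := by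
  set m : Fin N → ℤ := fun k => (k : ℤ) - (N : ℤ) / 2 with hm_def
  have hm : Function.Injective m := fun k l h => by
    simp only [hm_def] at h
    ext
    omega
  have hmN (k l : Fin N) : |m l - m k| < N := by
    simp only [hm_def, abs_lt]
    omega
  set E : Fin N → ℝ → ℂ := fun k x => Complex.exp (Complex.I * ω * (m k : ℂ) * x) with hE
  have hrange : TN = LinearMap.range (Fintype.linearCombination ℂ E) := by
    rw [hTN, Fintype.range_linearCombination]
  have hΦ (c : Fin N → ℂ) (x : ℝ) : Fintype.linearCombination ℂ E c x =
      ∑ k, c k * Complex.exp (Complex.I * ω * (m k : ℂ) * x) := by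
    simp [Fintype.linearCombination_apply, hE]
  have hgrid (c : Fin N → ℂ) := sum_norm_sq_sum_exp hNpos hd hω hΔx hm hmN c
  simp only [← hΦ] at hgrid
  let ev : (ℝ → ℂ) →ₗ[ℂ] (Fin N → ℂ) := LinearMap.funLeft ℂ ℂ fun j : Fin N => (j : ℕ) * Δx
  have hinj : Function.Injective (ev ∘ₗ Fintype.linearCombination ℂ E) := by
    rw [← LinearMap.ker_eq_bot, LinearMap.ker_eq_bot']
    intro c hc
    have h0 (j : Fin N) : Fintype.linearCombination ℂ E c ((j : ℕ) * Δx) = 0 := congrFun hc j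
    have h := hgrid c
    simp only [h0, norm_zero, ne_eq, OfNat.ofNat_ne_zero, not_false_eq_true, zero_pow,
      Finset.sum_const_zero] at h
    have hs : ∑ k, ‖c k‖ ^ 2 = 0 :=
      (mul_eq_zero.mp h.symm).resolve_right (by exact_mod_cast hNpos.ne')
    rw [Finset.sum_eq_zero_iff_of_nonneg fun _ _ => by positivity] at hs
    ext k
    simpa using hs k (Finset.mem_univ k)
  have hsurj := LinearMap.injective_iff_surjective.mp hinj
  refine ⟨⟨LinearEquiv.ofBijective (ev ∘ₗ TN.subtype) ⟨?_, fun v => ?_⟩, fun q => rfl⟩, ?_⟩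
  · rw [← LinearMap.ker_eq_bot, LinearMap.ker_eq_bot']
    rintro ⟨q, hq⟩ hq0
    obtain ⟨c, rfl⟩ := hrange ▸ hq
    have hc : c = 0 := hinj (by simpa using hq0)
    simp [hc]
  · obtain ⟨c, hc⟩ := hsurj v
    exact ⟨⟨_, hrange ▸ LinearMap.mem_range_self _ c⟩, hc⟩
  · intro q hq
    obtain ⟨c, rfl⟩ := hrange ▸ hq
    have hint := integral_norm_sq_sum_exp hd hω hm c
    simp only [← hΦ] at hint
    have hN0 : (N : ℝ) ≠ 0 := by exact_mod_cast hNpos.ne'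
    rw [hint, hgrid, ← Real.sqrt_mul (by rw [hΔx]; positivity), hΔx]
    congr 1
    field_simp
end

section
/- For an integer p ≥ 1, let α_j = 2(−1)^{j+1}(p!)²/((p+j)!(p−j)!) for 1 ≤ j ≤ p and let c_p^{−1} = Σ_{j=1}^p |α_j|/j. Then: (i) |α_j| ≤ 2 for all 1 ≤ j ≤ p, and hence c_p^{−1} ≤ 2 Σ_{j=1}^p 1/j; (ii) |α_j| ≥ 2/e for all 1 ≤ j ≤ √p − 1, and hence, with r = ⌊√p⌋ − 1, c_p^{−1} ≥ (2/e) Σ_{j=1}^{r} 1/j. In particular c_p^{−1} = Θ(log p) as p → ∞. -/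
open Real Filter

/-- `c_p⁻¹ = Σ_{j=1}^p |α_j|/j`. -/
noncomputable def fdCpInv (p : ℕ) : ℝ := ∑ j ∈ Finset.Icc 1 p, |fdAlpha p j| / j

theorem abs_fdAlpha (p j : ℕ) :
    |fdAlpha p j| = 2 * (p.factorial : ℝ) ^ 2 / ((p + j).factorial * (p - j).factorial) := by
  simp [fdAlpha, abs_div, abs_mul]

theorem factorial_eq_factorial_sub_mul_prod {p j : ℕ} (h : j ≤ p) :
    (p.factorial : ℝ) = (p - j).factorial * ∏ i ∈ Finset.range j, ((p - j + 1 + i : ℕ) : ℝ) := by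
  rw [← Nat.cast_prod, ← Nat.ascFactorial_eq_prod_range, ← Nat.cast_mul,
    Nat.factorial_mul_ascFactorial, Nat.sub_add_cancel h]

theorem factorial_add_eq_factorial_mul_prod (p j : ℕ) :
    ((p + j).factorial : ℝ) = p.factorial * ∏ i ∈ Finset.range j, ((p + 1 + i : ℕ) : ℝ) := by
  rw [← Nat.cast_prod, ← Nat.ascFactorial_eq_prod_range, ← Nat.cast_mul,
    Nat.factorial_mul_ascFactorial]

/-- `|α_j|` is twice a quotient of two products of `j` consecutive integers. -/
theorem abs_fdAlpha_eq_prod_div_prod {p j : ℕ} (h : j ≤ p) :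
    |fdAlpha p j| = 2 * (∏ i ∈ Finset.range j, ((p - j + 1 + i : ℕ) : ℝ)) /
      ∏ i ∈ Finset.range j, ((p + 1 + i : ℕ) : ℝ) := by
  have hprod : (∏ i ∈ Finset.range j, ((p + 1 + i : ℕ) : ℝ)) ≠ 0 := by positivity
  rw [abs_fdAlpha, factorial_add_eq_factorial_mul_prod, div_eq_div_iff (by positivity) hprod]
  linear_combination 2 * (p.factorial : ℝ) * (∏ i ∈ Finset.range j, ((p + 1 + i : ℕ) : ℝ)) *
    factorial_eq_factorial_sub_mul_prod h

theorem abs_fdAlpha_le_two {p j : ℕ} (h : j ≤ p) : |fdAlpha p j| ≤ 2 := by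
  rw [abs_fdAlpha_eq_prod_div_prod h, div_le_iff₀ (by positivity)]
  gcongr
  omega

theorem two_div_exp_one_le_abs_fdAlpha {p j : ℕ} (hj : 1 ≤ j) (h : (j + 1) ^ 2 ≤ p) :
    2 / exp 1 ≤ |fdAlpha p j| := by
  have hjp : j ≤ p := by nlinarith
  have hj0 : (0 : ℝ) < j := by exact_mod_cast hj
  have key : ∏ i ∈ Finset.range j, ((p + 1 + i : ℕ) : ℝ) ≤
      exp 1 * ∏ i ∈ Finset.range j, ((p - j + 1 + i : ℕ) : ℝ) := by
    calc ∏ i ∈ Finset.range j, ((p + 1 + i : ℕ) : ℝ)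
        ≤ ∏ i ∈ Finset.range j, (exp (1 / j) * ((p - j + 1 + i : ℕ) : ℝ)) := by
          refine Finset.prod_le_prod (fun i _ => by positivity) fun i _ => ?_
          obtain ⟨m, rfl⟩ := Nat.exists_eq_add_of_le hjp
          have hm : j * j ≤ m + 1 + i := by nlinarith
          have hm' : (j : ℝ) * j ≤ ((m + 1 + i : ℕ) : ℝ) := by exact_mod_cast hm
          rw [Nat.add_sub_cancel_left]
          calc ((j + m + 1 + i : ℕ) : ℝ) = j + ((m + 1 + i : ℕ) : ℝ) := by push_cast; ring
            _ ≤ 1 / j * ((m + 1 + i : ℕ) : ℝ) + ((m + 1 + i : ℕ) : ℝ) := by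
              gcongr
              rwa [one_div_mul_eq_div, le_div_iff₀ hj0]
            _ = (1 / j + 1) * ((m + 1 + i : ℕ) : ℝ) := by ring
            _ ≤ exp (1 / j) * ((m + 1 + i : ℕ) : ℝ) := by
              gcongr
              exact add_one_le_exp _
      _ = exp 1 * ∏ i ∈ Finset.range j, ((p - j + 1 + i : ℕ) : ℝ) := by
          rw [Finset.prod_mul_distrib, Finset.prod_const, Finset.card_range, ← exp_nat_mul,
            mul_one_div_cancel hj0.ne']
  rw [abs_fdAlpha_eq_prod_div_prod hjp, div_le_div_iff₀ (exp_pos 1) (by positivity)]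
  linarith

theorem fdCpInv_le_two_mul_sum (p : ℕ) :
    fdCpInv p ≤ 2 * ∑ j ∈ Finset.Icc 1 p, (1 : ℝ) / j := by
  rw [fdCpInv, Finset.mul_sum]
  refine Finset.sum_le_sum fun j hj => ?_
  rw [mul_one_div]
  gcongr
  exact abs_fdAlpha_le_two (Finset.mem_Icc.mp hj).2

theorem two_div_exp_one_mul_sum_le_fdCpInv (p : ℕ) :
    2 / exp 1 * ∑ j ∈ Finset.Icc 1 (Nat.sqrt p - 1), (1 : ℝ) / j ≤ fdCpInv p := by
  have hsub : Finset.Icc 1 (Nat.sqrt p - 1) ⊆ Finset.Icc 1 p :=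
    Finset.Icc_subset_Icc_right ((Nat.sub_le _ _).trans (Nat.sqrt_le_self p))
  rw [fdCpInv, Finset.mul_sum]
  refine (Finset.sum_le_sum fun j hj => ?_).trans
    (Finset.sum_le_sum_of_subset_of_nonneg hsub fun j _ _ => by positivity)
  obtain ⟨h1, h2⟩ := Finset.mem_Icc.mp hj
  rw [mul_one_div]
  gcongr
  refine two_div_exp_one_le_abs_fdAlpha h1 ?_
  rw [← Nat.le_sqrt']
  omega

theorem sum_Icc_one_div_eq_harmonic (n : ℕ) :
    ∑ j ∈ Finset.Icc 1 n, (1 : ℝ) / j = (harmonic n : ℝ) := by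
  simp [harmonic_eq_sum_Icc]

theorem log_le_four_mul_log_sqrt {p : ℕ} (hp : 4 ≤ p) :
    log p ≤ 4 * log (Nat.sqrt p) := by
  have hs : 2 ≤ Nat.sqrt p := Nat.le_sqrt.mpr hp
  have hle : p ≤ Nat.sqrt p ^ 4 := calc
    p ≤ (Nat.sqrt p + 1) ^ 2 := (Nat.lt_succ_sqrt' p).le
    _ ≤ (Nat.sqrt p ^ 2) ^ 2 := Nat.pow_le_pow_left (by nlinarith) 2
    _ = Nat.sqrt p ^ 4 := by ring
  have hle' : (p : ℝ) ≤ (Nat.sqrt p : ℝ) ^ 4 := by exact_mod_cast hle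
  calc log p ≤ log ((Nat.sqrt p : ℝ) ^ 4) := log_le_log (by positivity) hle'
    _ = 4 * log (Nat.sqrt p) := by rw [log_pow]; norm_num

theorem inv_two_mul_exp_one_mul_log_le_fdCpInv {p : ℕ} (hp : 4 ≤ p) :
    1 / (2 * exp 1) * log p ≤ fdCpInv p := by
  have hs : 2 ≤ Nat.sqrt p := Nat.le_sqrt.mpr hp
  have hlog := log_add_one_le_harmonic (Nat.sqrt p - 1)
  rw [Nat.sub_add_cancel (by omega), ← sum_Icc_one_div_eq_harmonic] at hlog
  calc 1 / (2 * exp 1) * log p ≤ 1 / (2 * exp 1) * (4 * log (Nat.sqrt p)) := by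
        gcongr
        exact log_le_four_mul_log_sqrt hp
    _ = 2 / exp 1 * log (Nat.sqrt p) := by field_simp; norm_num
    _ ≤ 2 / exp 1 * ∑ j ∈ Finset.Icc 1 (Nat.sqrt p - 1), (1 : ℝ) / j := by gcongr
    _ ≤ fdCpInv p := two_div_exp_one_mul_sum_le_fdCpInv p

theorem fdCpInv_le_four_mul_log {p : ℕ} (hp : 4 ≤ p) : fdCpInv p ≤ 4 * log p := by
  have hp' : (4 : ℝ) ≤ p := by exact_mod_cast hp
  have hlog : 1 ≤ log p := by
    rw [le_log_iff_exp_le (by linarith)]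
    linarith [exp_one_lt_d9]
  have hH := harmonic_le_one_add_log p
  have hC := fdCpInv_le_two_mul_sum p
  rw [sum_Icc_one_div_eq_harmonic] at hC
  linarith

/-- Asymptotics of the normalizing constant: (i) `|α_j| ≤ 2`, hence
`c_p⁻¹ ≤ 2 Σ_{j=1}^p 1/j`; (ii) `|α_j| ≥ 2/e` for `1 ≤ j ≤ √p − 1`, hence
`c_p⁻¹ ≥ (2/e) Σ_{j=1}^{⌊√p⌋−1} 1/j`; in particular `c_p⁻¹ = Θ(log p)`. -/
theorem cpInv_asymptotics :
    (∀ p : ℕ, 1 ≤ p → ∀ j ∈ Finset.Icc 1 p, |fdAlpha p j| ≤ 2) ∧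
    (∀ p : ℕ, 1 ≤ p → fdCpInv p ≤ 2 * ∑ j ∈ Finset.Icc 1 p, (1 : ℝ) / j) ∧
    (∀ p : ℕ, 1 ≤ p → ∀ j : ℕ, 1 ≤ j → (j : ℝ) ≤ Real.sqrt p - 1 →
      2 / Real.exp 1 ≤ |fdAlpha p j|) ∧
    (∀ p : ℕ, 1 ≤ p →
      (2 / Real.exp 1) * ∑ j ∈ Finset.Icc 1 (Nat.sqrt p - 1), (1 : ℝ) / j ≤ fdCpInv p) ∧
    (∃ A B : ℝ, 0 < A ∧ 0 < B ∧
      ∀ᶠ p : ℕ in atTop, A * Real.log p ≤ fdCpInv p ∧ fdCpInv p ≤ B * Real.log p) := by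
  refine ⟨fun p _ j hj => abs_fdAlpha_le_two (Finset.mem_Icc.mp hj).2,
    fun p _ => fdCpInv_le_two_mul_sum p, fun p _ j hj h => ?_,
    fun p _ => two_div_exp_one_mul_sum_le_fdCpInv p,
    1 / (2 * exp 1), 4, by positivity, by norm_num, ?_⟩
  · refine two_div_exp_one_le_abs_fdAlpha hj ?_
    have h' : (j : ℝ) + 1 ≤ √p := by linarith
    exact_mod_cast (le_sqrt' (by positivity)).mp h'
  · filter_upwards [eventually_ge_atTop 4] with p hp
    exact ⟨inv_two_mul_exp_one_mul_log_le_fdCpInv hp, fdCpInv_le_four_mul_log hp⟩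
end

section
/- Fix an integer p ≥ 1, d > 0, a positive integer N, Δx = d/N and ω = 2π/d. Define λ(k) = Σ_{j=1}^p α_j sin(ωkjΔx)/(jΔx) and μ(k) = Σ_{j=1}^p α_j (2 − 2cos(ωkjΔx))/(jΔx)² for real k, where α_j = 2(−1)^{j+1}(p!)²/((p+j)!(p−j)!). Then λ(−k) = −λ(k) and μ(−k) = μ(k) for all real k, and for every real k ≥ 0 one has λ(k) ≤ ωk and μ(k) ≤ ω²k². -/
open Real

/-- The eigenvalue symbol `λ(k) = Σ_{j=1}^p α_j sin(ωkjΔx)/(jΔx)` of `D_{2p}`. -/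
noncomputable def fdLambda (p : ℕ) (ω Δx : ℝ) (k : ℝ) : ℝ :=
  ∑ j ∈ Finset.Icc 1 p, fdAlpha p j * Real.sin (ω * k * j * Δx) / (j * Δx)

/-- The eigenvalue symbol `μ(k) = Σ_{j=1}^p α_j (2 − 2cos(ωkjΔx))/(jΔx)²` of `D^{(2)}_{2p}`. -/
noncomputable def fdMu (p : ℕ) (ω Δx : ℝ) (k : ℝ) : ℝ :=
  ∑ j ∈ Finset.Icc 1 p, fdAlpha p j * (2 - 2 * Real.cos (ω * k * j * Δx)) / (j * Δx) ^ 2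

/-- The binomial expansion of `(2 - 2 cos x) ^ p` as a trigonometric polynomial. -/
theorem two_sub_two_cos_pow (p : ℕ) (x : ℝ) :
    (2 - 2 * cos x) ^ p =
      ∑ m ∈ Finset.range (2 * p + 1),
        (-1 : ℝ) ^ (m + p) * ((2 * p).choose m : ℝ) * cos (((m : ℝ) - p) * x) := by
  have hexp : ∀ m : ℕ, Complex.exp (x * Complex.I) ^ m * Complex.exp (-(x * Complex.I)) ^ p =
      Complex.exp (((((m : ℝ) - p) * x : ℝ) : ℂ) * Complex.I) := by
    intro m
    rw [← Complex.exp_nat_mul, ← Complex.exp_nat_mul, ← Complex.exp_add]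
    congr 1
    push_cast
    ring
  have hmul : Complex.exp (x * Complex.I) * Complex.exp (-(x * Complex.I)) = 1 := by
    rw [← Complex.exp_add, add_neg_cancel, Complex.exp_zero]
  have hcos : (2 : ℂ) - 2 * Complex.cos x =
      -(1 - Complex.exp (x * Complex.I)) ^ 2 * Complex.exp (-(x * Complex.I)) := by
    rw [Complex.cos, neg_mul]
    linear_combination (2 - Complex.exp (x * Complex.I)) * (-hmul)
  have hsum : (((2 - 2 * cos x) ^ p : ℝ) : ℂ) =
      ∑ m ∈ Finset.range (2 * p + 1),
        (((-1 : ℝ) ^ (m + p) * ((2 * p).choose m : ℝ) : ℝ) : ℂ) *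
          Complex.exp (((((m : ℝ) - p) * x : ℝ) : ℂ) * Complex.I) := by
    push_cast
    rw [hcos, mul_pow, neg_pow, ← pow_mul, sub_eq_neg_add, add_pow, Finset.mul_sum,
      Finset.sum_mul]
    refine Finset.sum_congr rfl fun m _ => ?_
    have := hexp m
    push_cast at this
    rw [← this, neg_pow (Complex.exp _) m, one_pow, pow_add]
    ring
  have hre := congrArg Complex.re hsum
  rw [Complex.ofReal_re, Complex.re_sum] at hre
  rw [hre]
  refine Finset.sum_congr rfl fun m _ => ?_
  rw [Complex.re_ofReal_mul, Complex.exp_ofReal_mul_I_re]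

theorem fdAlpha_mul_choose {p j : ℕ} (hj : j ≤ p) :
    fdAlpha p j * ((2 * p).choose p : ℝ) =
      2 * (-1 : ℝ) ^ (j + 1) * ((2 * p).choose (p + j) : ℝ) := by
  rw [Nat.cast_choose ℝ (by omega : p ≤ 2 * p), Nat.cast_choose ℝ (by omega : p + j ≤ 2 * p),
    show 2 * p - p = p by omega, show 2 * p - (p + j) = p - j by omega, fdAlpha]
  have h := fun n : ℕ => (Nat.cast_ne_zero (R := ℝ)).2 n.factorial_ne_zero
  have h1 := h p
  have h2 := h (p + j)
  have h3 := h (p - j)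
  field_simp

/-- The symbol of `D_{2p}` has derivative `1 - (2 - 2 cos x) ^ p / (2p choose p)`. -/
theorem sum_fdAlpha_mul_cos (p : ℕ) (x : ℝ) :
    ∑ j ∈ Finset.Icc 1 p, fdAlpha p j * cos (j * x) =
      1 - (2 - 2 * cos x) ^ p / ((2 * p).choose p : ℝ) := by
  have hC : ((2 * p).choose p : ℝ) ≠ 0 :=
    Nat.cast_ne_zero.2 (Nat.choose_pos (by omega)).ne'
  have hIcc : ∑ j ∈ Finset.Icc 1 p, fdAlpha p j * cos (j * x) =
      ∑ i ∈ Finset.range p, fdAlpha p (1 + i) * cos ((1 + i : ℕ) * x) := by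
    rw [← Finset.Ico_add_one_right_eq_Icc, Finset.sum_Ico_eq_sum_range, Nat.add_sub_cancel]
  have hsq : (-1 : ℝ) ^ (p + p) = 1 := Even.neg_one_pow ⟨p, rfl⟩
  have hsplit := two_sub_two_cos_pow p x
  rw [show 2 * p + 1 = p + (p + 1) by omega, Finset.sum_range_add, Finset.sum_range_succ',
    ← Finset.sum_range_reflect, ← add_assoc, ← Finset.sum_add_distrib] at hsplit
  rw [hIcc, eq_sub_iff_add_eq, ← eq_sub_iff_add_eq', div_eq_iff hC, sub_mul, Finset.sum_mul,
    one_mul, hsplit, add_zero, sub_self, zero_mul, cos_zero, hsq, one_mul, mul_one, add_comm,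
    sub_eq_add_neg, ← Finset.sum_neg_distrib]
  congr 1
  refine Finset.sum_congr rfl fun i hi => ?_
  have hi : i < p := Finset.mem_range.1 hi
  obtain ⟨q, rfl⟩ : ∃ q, p = q + i + 1 := ⟨p - i - 1, by omega⟩
  have hα := fdAlpha_mul_choose (p := q + i + 1) (j := 1 + i) (by omega)
  have hsymm : (2 * (q + i + 1)).choose q =
      (2 * (q + i + 1)).choose (q + i + 1 + (i + 1)) :=
    Nat.choose_symm_of_eq_add (by omega)
  rw [show q + i + 1 - 1 - i = q by omega, hsymm]
  rw [add_comm 1 i] at hα ⊢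
  have hneg : (((q : ℕ) : ℝ) - (q + i + 1 : ℕ)) * x = -(((i + 1 : ℕ) : ℝ) * x) := by
    push_cast; ring
  have hpos : (((q + i + 1 + (i + 1) : ℕ) : ℝ) - (q + i + 1 : ℕ)) * x =
      ((i + 1 : ℕ) : ℝ) * x := by
    push_cast; ring
  have hs1 : (-1 : ℝ) ^ (q + (q + i + 1)) = (-1) ^ (i + 1) := by
    rw [show q + (q + i + 1) = 2 * q + (i + 1) by ring, pow_add, pow_mul]; simp
  have hs2 : (-1 : ℝ) ^ (q + i + 1 + (i + 1) + (q + i + 1)) = (-1) ^ (i + 1) := by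
    rw [show q + i + 1 + (i + 1) + (q + i + 1) = 2 * (q + i + 1) + (i + 1) by ring, pow_add,
      pow_mul]
    simp
  rw [hneg, hpos, hs1, hs2, cos_neg]
  linear_combination (cos (((i + 1 : ℕ) : ℝ) * x)) * hα

theorem sum_fdAlpha_mul_cos_le_one (p : ℕ) (x : ℝ) :
    ∑ j ∈ Finset.Icc 1 p, fdAlpha p j * cos (j * x) ≤ 1 := by
  rw [sum_fdAlpha_mul_cos]
  have : 0 ≤ 2 - 2 * cos x := by linarith [cos_le_one x]
  exact sub_le_self _ (by positivity)

/-- A function whose derivative is nonnegative on the positive reals is at least its value at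
zero there. -/
theorem apply_zero_le_of_hasDerivAt_nonneg {f f' : ℝ → ℝ} (hf : ∀ x, HasDerivAt f (f' x) x)
    (hf' : ∀ x, 0 ≤ x → 0 ≤ f' x) {x : ℝ} (hx : 0 ≤ x) : f 0 ≤ f x := by
  refine monotoneOn_of_deriv_nonneg (convex_Ici 0)
    (fun y _ => (hf y).continuousAt.continuousWithinAt)
    (fun y _ => (hf y).differentiableAt.differentiableWithinAt) (fun y hy => ?_)
    Set.self_mem_Ici hx hx
  rw [(hf y).deriv]
  exact hf' y (interior_subset hy)

theorem sum_fdAlpha_mul_sin_div_le (p : ℕ) {x : ℝ} (hx : 0 ≤ x) :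
    ∑ j ∈ Finset.Icc 1 p, fdAlpha p j * sin (j * x) / j ≤ x := by
  have hderiv : ∀ y : ℝ, HasDerivAt
      (fun y => y - ∑ j ∈ Finset.Icc 1 p, fdAlpha p j * sin (j * y) / j)
      (1 - ∑ j ∈ Finset.Icc 1 p, fdAlpha p j * cos (j * y)) y := by
    intro y
    refine (hasDerivAt_id y).sub (HasDerivAt.fun_sum fun j hj => ?_)
    have hj0 : (j : ℝ) ≠ 0 := Nat.cast_ne_zero.2 (by have := (Finset.mem_Icc.1 hj).1; omega)
    have h := (((hasDerivAt_id' y).const_mul (j : ℝ)).sin.const_mul (fdAlpha p j)).div_const (j : ℝ)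
    exact h.congr_deriv (by field_simp)
  have h := apply_zero_le_of_hasDerivAt_nonneg hderiv
    (fun y _ => sub_nonneg.2 (sum_fdAlpha_mul_cos_le_one p y)) hx
  simpa using h

theorem sum_fdAlpha_mul_two_sub_two_cos_div_le (p : ℕ) {x : ℝ} (hx : 0 ≤ x) :
    ∑ j ∈ Finset.Icc 1 p, fdAlpha p j * (2 - 2 * cos (j * x)) / (j : ℝ) ^ 2 ≤ x ^ 2 := by
  have hderiv : ∀ y : ℝ, HasDerivAt
      (fun y => y ^ 2 - ∑ j ∈ Finset.Icc 1 p, fdAlpha p j * (2 - 2 * cos (j * y)) / (j : ℝ) ^ 2)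
      (2 * y - ∑ j ∈ Finset.Icc 1 p, 2 * (fdAlpha p j * sin (j * y) / j)) y := by
    intro y
    refine HasDerivAt.sub (by simpa using hasDerivAt_pow 2 y) (HasDerivAt.fun_sum fun j hj => ?_)
    have hj0 : (j : ℝ) ≠ 0 := Nat.cast_ne_zero.2 (by have := (Finset.mem_Icc.1 hj).1; omega)
    have h := ((((hasDerivAt_id' y).const_mul (j : ℝ)).cos.const_mul 2).const_sub 2
      |>.const_mul (fdAlpha p j)).div_const ((j : ℝ) ^ 2)
    exact h.congr_deriv (by field_simp)
  have h := apply_zero_le_of_hasDerivAt_nonneg hderiv (fun y hy => by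
    rw [← Finset.mul_sum]
    linarith [sum_fdAlpha_mul_sin_div_le p hy]) hx
  simpa using h

theorem fdLambda_neg (p : ℕ) (ω Δx k : ℝ) : fdLambda p ω Δx (-k) = -fdLambda p ω Δx k := by
  simp [fdLambda, neg_div]

theorem fdMu_neg (p : ℕ) (ω Δx k : ℝ) : fdMu p ω Δx (-k) = fdMu p ω Δx k := by
  simp [fdMu]

theorem fdLambda_le (p : ℕ) {ω Δx k : ℝ} (hω : 0 ≤ ω) (hΔx : 0 < Δx) (hk : 0 ≤ k) :
    fdLambda p ω Δx k ≤ ω * k := by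
  have h : fdLambda p ω Δx k =
      (∑ j ∈ Finset.Icc 1 p, fdAlpha p j * sin (j * (ω * k * Δx)) / j) / Δx := by
    rw [fdLambda, Finset.sum_div]
    refine Finset.sum_congr rfl fun j _ => ?_
    rw [div_div, show ω * k * j * Δx = j * (ω * k * Δx) by ring]
  rw [h, div_le_iff₀ hΔx]
  exact sum_fdAlpha_mul_sin_div_le p (by positivity)

theorem fdMu_le (p : ℕ) {ω Δx k : ℝ} (hω : 0 ≤ ω) (hΔx : 0 < Δx) (hk : 0 ≤ k) :
    fdMu p ω Δx k ≤ ω ^ 2 * k ^ 2 := by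
  have h : fdMu p ω Δx k =
      (∑ j ∈ Finset.Icc 1 p,
        fdAlpha p j * (2 - 2 * cos (j * (ω * k * Δx))) / (j : ℝ) ^ 2) / Δx ^ 2 := by
    rw [fdMu, Finset.sum_div]
    refine Finset.sum_congr rfl fun j _ => ?_
    rw [div_div, ← mul_pow, show ω * k * j * Δx = j * (ω * k * Δx) by ring]
  rw [h, div_le_iff₀ (by positivity), ← mul_pow, ← mul_pow]
  exact sum_fdAlpha_mul_two_sub_two_cos_div_le p (by positivity)

/-- Symmetry and upper bounds for the eigenvalue symbols: `λ` is odd, `μ` is even, and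
`λ(k) ≤ ωk`, `μ(k) ≤ ω²k²` for all real `k ≥ 0`. -/
theorem lambda_mu_symmetry_and_bounds (p : ℕ) (hp : 1 ≤ p) (d : ℝ) (hd : 0 < d)
    (N : ℕ) (hN : 0 < N) (ω Δx : ℝ) (hω : ω = 2 * Real.pi / d) (hΔx : Δx = d / N) :
    (∀ k : ℝ, fdLambda p ω Δx (-k) = -fdLambda p ω Δx k) ∧
    (∀ k : ℝ, fdMu p ω Δx (-k) = fdMu p ω Δx k) ∧
    (∀ k : ℝ, 0 ≤ k → fdLambda p ω Δx k ≤ ω * k) ∧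
    (∀ k : ℝ, 0 ≤ k → fdMu p ω Δx k ≤ ω ^ 2 * k ^ 2) := by
  have hω0 : 0 ≤ ω := by rw [hω]; positivity
  have hΔx0 : 0 < Δx := by rw [hΔx]; positivity
  exact ⟨fdLambda_neg p ω Δx, fdMu_neg p ω Δx, fun k hk => fdLambda_le p hω0 hΔx0 hk,
    fun k hk => fdMu_le p hω0 hΔx0 hk⟩
end
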